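/- arXiv:1509.06616 — 7 statements merged into one kernel-verified Lean document; each statement's English description precedes it below -/
import Mathlib

section
/- Let h : [0,∞) → [0,∞) be continuous with h(0) = 0 and with compact support, and define d_h(s,t) = h(s) + h(t) − 2·min_{r ∈ [s∧t, s∨t]} h(r). Then d_h satisfies the four-point (0-hyperbolicity) condition: for all s, t, u, v ≥ 0, d_h(s,t) + d_h(u,v) ≤ max( d_h(s,u) + d_h(t,v), d_h(s,v) + d_h(t,u) ). (This expresses that the metric space coded by h is an ℝ-tree.) -/
open scoped NNReal

/-- The pseudo-distance `d_h(s,t) = h(s) + h(t) - 2 * min_{r ∈ [s∧t, s∨t]} h(r)`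
coded by a function `h : [0,∞) → ℝ`. -/
noncomputable def treeDist (h : ℝ≥0 → ℝ) (s t : ℝ≥0) : ℝ :=
  h s + h t - 2 * sInf (h '' Set.uIcc s t)

/-- The infimum of a function over the interval between two points satisfies the reversed
ultrametric inequality. -/
lemma min_sInf_image_uIcc_le {α β : Type*} [LinearOrder α] [ConditionallyCompleteLinearOrder β]
    {f : α → β} (hf : BddBelow (Set.range f)) (x y z : α) :
    min (sInf (f '' Set.uIcc x y)) (sInf (f '' Set.uIcc y z)) ≤ sInf (f '' Set.uIcc x z) := by
  have hbdd (s : Set α) : BddBelow (f '' s) := hf.mono (Set.image_subset_range f s)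
  rw [← csInf_union (hbdd _) (Set.nonempty_uIcc.image f) (hbdd _) (Set.nonempty_uIcc.image f),
    ← Set.image_union]
  exact csInf_le_csInf (hbdd _) (Set.nonempty_uIcc.image f)
    (Set.image_mono Set.uIcc_subset_uIcc_union_uIcc)

/-- A symmetric function satisfying the reversed ultrametric inequality satisfies the
reversed four-point condition. -/
lemma min_add_add_le_of_min_le {α : Type*} {m : α → α → ℝ} (hsymm : ∀ x y, m x y = m y x)
    (hm : ∀ x y z, min (m x y) (m y z) ≤ m x z) (s t u v : α) :
    min (m s u + m t v) (m s v + m t u) ≤ m s t + m u v := by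
  have h₁ := hm s u t
  have h₂ := hm s v t
  have h₃ := hm u s v
  have h₄ := hm u t v
  rw [hsymm u t] at h₁ h₄
  rw [hsymm v t] at h₂
  rw [hsymm u s] at h₃
  grind

/-- For `h : [0,∞) → [0,∞)` continuous with `h 0 = 0` and compact support, `d_h`
satisfies the four-point (0-hyperbolicity) condition:
`d_h(s,t) + d_h(u,v) ≤ max (d_h(s,u) + d_h(t,v)) (d_h(s,v) + d_h(t,u))`,
expressing that the metric space coded by `h` is an ℝ-tree. -/
theorem treeDist_fourPoint (h : ℝ≥0 → ℝ)
    (hcont : Continuous h) (h0 : h 0 = 0) (hsupp : HasCompactSupport h)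
    (hnonneg : ∀ x, 0 ≤ h x) :
    ∀ s t u v : ℝ≥0,
      treeDist h s t + treeDist h u v ≤
        max (treeDist h s u + treeDist h t v) (treeDist h s v + treeDist h t u) := by
  intro s t u v
  have hf : BddBelow (Set.range h) := ⟨0, Set.forall_mem_range.2 hnonneg⟩
  have key := min_add_add_le_of_min_le (m := fun x y => sInf (h '' Set.uIcc x y))
    (fun x y => by rw [Set.uIcc_comm]) (min_sInf_image_uIcc_le hf) s t u v
  simp only [treeDist]
  grind
end

section
/- Let h : [0,∞) → [0,∞) be continuous with h(0) = 0 and with compact support, and define d_h(s,t) = h(s) + h(t) − 2·min_{r ∈ [s∧t, s∨t]} h(r). Define the equivalence relation s ∼_h t iff d_h(s,t) = 0. Then d_h induces a metric on the quotient space T_h := [0,∞)/∼_h, and the resulting metric space (T_h, d_h) is compact. -/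
open scoped NNReal

open Filter Topology

section TreeDist

variable {h : ℝ≥0 → ℝ}

theorem exists_mem_uIcc_eq_sInf (hcont : Continuous h) (s t : ℝ≥0) :
    ∃ r ∈ Set.uIcc s t, sInf (h '' Set.uIcc s t) = h r :=
  isCompact_uIcc.exists_sInf_image_eq Set.nonempty_uIcc hcont.continuousOn

theorem sInf_image_uIcc_le (hcont : Continuous h) {s t r : ℝ≥0} (hr : r ∈ Set.uIcc s t) :
    sInf (h '' Set.uIcc s t) ≤ h r :=
  csInf_le (isCompact_uIcc.image hcont).bddBelow (Set.mem_image_of_mem h hr)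

theorem treeDist_self (h : ℝ≥0 → ℝ) (s : ℝ≥0) : treeDist h s s = 0 := by
  simp [treeDist]
  ring

theorem treeDist_comm (h : ℝ≥0 → ℝ) (s t : ℝ≥0) : treeDist h s t = treeDist h t s := by
  rw [treeDist, treeDist, Set.uIcc_comm, add_comm (h s)]

theorem treeDist_nonneg (hcont : Continuous h) (s t : ℝ≥0) : 0 ≤ treeDist h s t := by
  have hs := sInf_image_uIcc_le hcont (Set.left_mem_uIcc (a := s) (b := t))
  have ht := sInf_image_uIcc_le hcont (Set.right_mem_uIcc (a := s) (b := t))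
  rw [treeDist]
  linarith

theorem treeDist_triangle (hcont : Continuous h) (s t u : ℝ≥0) :
    treeDist h s u ≤ treeDist h s t + treeDist h t u := by
  obtain ⟨r, hr, hmin⟩ := exists_mem_uIcc_eq_sInf hcont s u
  have hst := sInf_image_uIcc_le hcont (Set.right_mem_uIcc (a := s) (b := t))
  have htu := sInf_image_uIcc_le hcont (Set.left_mem_uIcc (a := t) (b := u))
  simp only [treeDist, hmin]
  rcases Set.uIcc_subset_uIcc_union_uIcc (b := t) hr with hr | hr <;>
    linarith [sInf_image_uIcc_le hcont hr]

theorem treeDist_congr_left (hcont : Continuous h) {s t : ℝ≥0} (hst : treeDist h s t = 0)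
    (u : ℝ≥0) : treeDist h s u = treeDist h t u := by
  have h₁ := treeDist_triangle hcont s t u
  have h₂ := treeDist_triangle hcont t s u
  rw [treeDist_comm h t s] at h₂
  linarith

theorem treeDist_congr_right (hcont : Continuous h) {t u : ℝ≥0} (htu : treeDist h t u = 0)
    (s : ℝ≥0) : treeDist h s t = treeDist h s u := by
  rw [treeDist_comm h s t, treeDist_comm h s u, treeDist_congr_left hcont htu]

theorem treeDist_zero_eq_zero (hcont : Continuous h) (h0 : h 0 = 0) (hnonneg : ∀ x, 0 ≤ h x)
    {t : ℝ≥0} (ht : h t = 0) : treeDist h t 0 = 0 := by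
  obtain ⟨r, -, hmin⟩ := exists_mem_uIcc_eq_sInf hcont t 0
  refine le_antisymm ?_ (treeDist_nonneg hcont t 0)
  rw [treeDist, hmin, ht, h0]
  linarith [hnonneg r]

theorem tendsto_treeDist_nhds (hcont : Continuous h) (s : ℝ≥0) :
    Tendsto (fun t => treeDist h t s) (𝓝 s) (𝓝 0) := by
  rw [Metric.tendsto_nhds]
  intro ε hε
  have hnear : ∀ᶠ r in 𝓝 s, |h r - h s| < ε / 4 :=
    Metric.tendsto_nhds.1 hcont.continuousAt (ε / 4) (by positivity)
  have huIcc : Tendsto (fun t => Set.uIcc t s) (𝓝 s) (𝓝 s).smallSets :=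
    tendsto_id.uIcc tendsto_const_nhds
  filter_upwards [hnear, huIcc.eventually hnear.smallSets] with t ht hall
  obtain ⟨r, hr, hmin⟩ := exists_mem_uIcc_eq_sInf hcont t s
  rw [Real.dist_0_eq_abs, abs_of_nonneg (treeDist_nonneg hcont t s), treeDist, hmin]
  linarith [(abs_lt.1 ht).2, (abs_lt.1 (hall r hr)).1]

/-- The metric induced by `treeDist h` on the quotient of `[0,∞)`. -/
noncomputable abbrev treeDistMetricSpace (hcont : Continuous h) :
    MetricSpace (Quot fun s t : ℝ≥0 => treeDist h s t = 0) where
  dist := Quot.lift₂ (treeDist h) (fun s _ _ htu => treeDist_congr_right hcont htu s)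
    (fun _ _ u hst => treeDist_congr_left hcont hst u)
  dist_self := by
    rintro ⟨s⟩
    exact treeDist_self h s
  dist_comm := by
    rintro ⟨s⟩ ⟨t⟩
    exact treeDist_comm h s t
  dist_triangle := by
    rintro ⟨s⟩ ⟨t⟩ ⟨u⟩
    exact treeDist_triangle hcont s t u
  eq_of_dist_eq_zero := by
    rintro ⟨s⟩ ⟨t⟩ hst
    exact Quot.sound hst

theorem compactSpace_of_dist_eq_treeDist {X : Type*} [MetricSpace X] {π : ℝ≥0 → X}
    (hcont : Continuous h) (h0 : h 0 = 0) (hsupp : HasCompactSupport h)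
    (hnonneg : ∀ x, 0 ≤ h x) (hsurj : Function.Surjective π)
    (hdist : ∀ s t, dist (π s) (π t) = treeDist h s t) : CompactSpace X := by
  have hπ : Continuous π := continuous_iff_continuousAt.2 fun s =>
    tendsto_iff_dist_tendsto_zero.2 (by simpa only [hdist] using tendsto_treeDist_nhds hcont s)
  have hK : IsCompact (insert 0 (tsupport h)) := hsupp.isCompact.insert 0
  refine ⟨(hK.image hπ).of_isClosed_subset isClosed_univ fun x _ => ?_⟩
  obtain ⟨t, rfl⟩ := hsurj x
  by_cases ht : h t = 0
  · refine ⟨0, Set.mem_insert _ _, (dist_eq_zero.1 ?_).symm⟩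
    rw [hdist, treeDist_zero_eq_zero hcont h0 hnonneg ht]
  · exact ⟨t, Set.mem_insert_of_mem _ (subset_tsupport h ht), rfl⟩

end TreeDist

/-- For `h : [0,∞) → [0,∞)` continuous with `h 0 = 0` and compact support, `d_h`
induces a metric on the quotient space `T_h = [0,∞) / {d_h = 0}`, and the resulting
metric space (the tree coded by `h`) is compact. -/
theorem treeDist_quotient_compact (h : ℝ≥0 → ℝ)
    (hcont : Continuous h) (h0 : h 0 = 0) (hsupp : HasCompactSupport h)
    (hnonneg : ∀ x, 0 ≤ h x) :
    ∃ m : MetricSpace (Quot fun s t : ℝ≥0 => treeDist h s t = 0),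
      (∀ s t : ℝ≥0,
        m.toPseudoMetricSpace.toDist.dist (Quot.mk _ s) (Quot.mk _ t) = treeDist h s t) ∧
      @CompactSpace _ m.toPseudoMetricSpace.toUniformSpace.toTopologicalSpace := by
  exact ⟨treeDistMetricSpace hcont, fun _ _ => rfl,
    @compactSpace_of_dist_eq_treeDist h _ (treeDistMetricSpace hcont) (Quot.mk _)
      hcont h0 hsupp hnonneg Quot.mk_surjective fun _ _ => rfl⟩
end

section
/- The map Δ sending a snake trajectory ω to the pair (h, f), where h(s) = ζ_s(ω) is the lifetime of ω_s and f(s) = ω̂_s is the endpoint of ω_s, is a bijection from the set S of all snake trajectories onto the set T of all tree-like paths, and both Δ and Δ⁻¹ are continuous for the distances d_S and d_T; moreover, if Δ(ω) = (h,f) then σ(ω) = σ_h (Marckert–Mokkadem homeomorphism theorem). -/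
open MeasureTheory

/-- A finite path: a continuous real function defined on the time interval
`[0, lifetime]`, encoded as a function on all of `ℝ` which is constant on
`(-∞, 0]` and on `[lifetime, ∞)` (stopped extension). -/
structure FinPath where
  /-- the lifetime `ζ_(w)` of the path -/
  lifetime : ℝ
  lifetime_nonneg : 0 ≤ lifetime
  /-- the path itself (extended by stopping outside `[0, lifetime]`) -/
  toFun : ℝ → ℝ
  cont : Continuous toFun
  stopped : ∀ t : ℝ, toFun t = toFun (min (max t 0) lifetime)

namespace FinPath

/-- the endpoint (tip) `ŵ = w(ζ_(w))` of a finite path -/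
def tip (w : FinPath) : ℝ := w.toFun w.lifetime

/-- the trivial path at `x`, with zero lifetime; it is identified with the point `x` -/
def triv (x : ℝ) : FinPath :=
  ⟨0, le_refl 0, fun _ => x, continuous_const, fun _ => rfl⟩

/-- the distance `d_W` on finite paths:
`d_W(w,w') = |ζ_(w) - ζ_(w')| + sup_t |w(t∧ζ_(w)) - w'(t∧ζ_(w'))|`. -/
noncomputable def dW (w w' : FinPath) : ℝ :=
  |w.lifetime - w'.lifetime| + ⨆ t : ℝ, |w.toFun t - w'.toFun t|

/-- the first hitting time `τ*_y(w) = inf {t ∈ (0, ζ_(w)] : w(t) = y}` of `y`,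
an extended real number (`⊤ = +∞` if the path does not hit `y` on `(0, ζ_(w)]`). -/
noncomputable def tauStar (y : ℝ) (w : FinPath) : EReal :=
  sInf ((fun t : ℝ => (t : EReal)) '' {t : ℝ | 0 < t ∧ t ≤ w.lifetime ∧ w.toFun t = y})

/-- the first hitting time `τ_y(w) = inf {t ∈ [0, ζ_(w)] : w(t) = y}` of `y`,
an extended real number (`⊤ = +∞` if the path does not hit `y`). -/
noncomputable def tau (y : ℝ) (w : FinPath) : EReal :=
  sInf ((fun t : ℝ => (t : EReal)) '' {t : ℝ | 0 ≤ t ∧ t ≤ w.lifetime ∧ w.toFun t = y})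

end FinPath

/-- `ω` is a snake trajectory with initial point `x`: the time parameter runs over
`[0,∞)` (the map is extended trivially to negative times), `ω_0 = x`, every path `ω_s`
starts at `x`, `ω` is continuous for `d_W`, `σ(ω) = sup {s : ω_s ≠ x} < ∞`, and the
snake property holds. -/
structure IsSnakeTraj (x : ℝ) (ω : ℝ → FinPath) : Prop where
  init : ∀ s : ℝ, s ≤ 0 → ω s = FinPath.triv x
  start : ∀ s : ℝ, (ω s).toFun 0 = x
  cont : ∀ s : ℝ, ∀ ε > (0:ℝ), ∃ δ > (0:ℝ), ∀ s' : ℝ,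
    |s' - s| < δ → FinPath.dW (ω s') (ω s) < ε
  finite : BddAbove {s : ℝ | ω s ≠ FinPath.triv x}
  snake : ∀ s s' : ℝ, 0 ≤ s → s ≤ s' → ∀ t : ℝ, 0 ≤ t →
    t ≤ sInf ((fun r => (ω r).lifetime) '' Set.Icc s s') →
    (ω s).toFun t = (ω s').toFun t

/-- the duration `σ(ω) = sup {s ≥ 0 : ω_s ≠ ω_0}` of a trajectory
(with the convention `sup ∅ = 0`, which is `Real.sSup`'s convention). -/
noncomputable def sigmaTraj (ω : ℝ → FinPath) : ℝ := sSup {s : ℝ | ω s ≠ ω 0}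

/-- the distance `d_S(ω,ω') = |σ(ω) - σ(ω')| + sup_s d_W(ω_s, ω'_s)`
on snake trajectories. -/
noncomputable def dS (ω ω' : ℝ → FinPath) : ℝ :=
  |sigmaTraj ω - sigmaTraj ω'| + ⨆ s : ℝ, FinPath.dW (ω s) (ω' s)

/-- `(h, f)` is a tree-like path: `h ≥ 0` and `f` are continuous, vanish
(resp. are constant) on `(-∞,0]` (time runs over `[0,∞)`),
`σ_h = sup {s : h s ≠ 0} < ∞`, and whenever `h(s) = h(s') = min_{[s,s']} h`
one has `f(s) = f(s')`. -/
structure IsTreeLike (h f : ℝ → ℝ) : Prop where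
  cont_h : Continuous h
  cont_f : Continuous f
  nonneg : ∀ s, 0 ≤ h s
  h_nonpos : ∀ s : ℝ, s ≤ 0 → h s = 0
  f_nonpos : ∀ s : ℝ, s ≤ 0 → f s = f 0
  finite : BddAbove {s : ℝ | h s ≠ 0}
  treeLike : ∀ s s' : ℝ, 0 ≤ s → s ≤ s' → h s = h s' →
    h s = sInf (h '' Set.Icc s s') → f s = f s'

/-- `σ_h = sup {s : h s ≠ 0}` (with `sup ∅ = 0`). -/
noncomputable def sigmaH (h : ℝ → ℝ) : ℝ := sSup {s : ℝ | h s ≠ 0}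

/-- the distance on tree-like paths:
`d_T((h,f),(h',f')) = |σ_h - σ_{h'}| + sup_s (|h s - h' s| + |f s - f' s|)`. -/
noncomputable def dT (h f h' f' : ℝ → ℝ) : ℝ :=
  |sigmaH h - sigmaH h'| + ⨆ s : ℝ, (|h s - h' s| + |f s - f' s|)

section Trunc

/-- `A_s = ∫_0^s 1{ζ_r(ω) ≤ τ*_y(ω_r)} dr`. -/
noncomputable def truncA (y : ℝ) (ω : ℝ → FinPath) (s : ℝ) : ℝ :=
  ∫ r in (0:ℝ)..s,
    Set.indicator {r : ℝ | ((ω r).lifetime : EReal) ≤ FinPath.tauStar y (ω r)}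
      (fun _ => (1:ℝ)) r

/-- `η_s = inf {r ≥ 0 : A_r > s}`. -/
noncomputable def truncEta (y : ℝ) (ω : ℝ → FinPath) (s : ℝ) : ℝ :=
  sInf {r : ℝ | truncA y ω r > s}

/-- the truncation `tr_y(ω)` of `ω` at `y`, defined by `tr_y(ω)_s = ω_{η_s}`
for `s ≥ 0` (and extended to negative times by the value at `0`). -/
noncomputable def trunc (y : ℝ) (ω : ℝ → FinPath) : ℝ → FinPath :=
  fun s => ω (truncEta y ω (max s 0))

end Trunc

section Sub

private lemma stop_aux (g : ℝ → ℝ) (c L : ℝ) (hL : 0 ≤ L) (t : ℝ) :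
    g (c + min (max t 0) L) = g (c + min (max (min (max t 0) L) 0) L) := by
  have h0u : 0 ≤ min (max t 0) L := le_min (le_max_right t 0) hL
  rw [max_eq_left h0u, min_eq_left (min_le_right _ _)]

/-- the time index `(a + s) ∧ b` (with `s` clamped to `[0,∞)`). -/
def subIdx (a b s : ℝ) : ℝ := min (a + max s 0) b

/-- The subtrajectory of `ω` associated with the interval `[a,b]`:
`(subPath ω a b)_s (t) = ω_{(a+s)∧b} (ζ_a + t)` for `0 ≤ t ≤ ζ_{(a+s)∧b} - ζ_a`.
(The lifetime is clamped at `0` to make the definition total; when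
`ζ_a = ζ_b = min_{[a,b]} ζ` this is the usual subtrajectory.) -/
noncomputable def subPath (ω : ℝ → FinPath) (a b : ℝ) (s : ℝ) : FinPath where
  lifetime := max 0 ((ω (subIdx a b s)).lifetime - (ω a).lifetime)
  lifetime_nonneg := le_max_left _ _
  toFun := fun t => (ω (subIdx a b s)).toFun ((ω a).lifetime +
    min (max t 0) (max 0 ((ω (subIdx a b s)).lifetime - (ω a).lifetime)))
  cont := by
    exact (ω (subIdx a b s)).cont.comp
      (continuous_const.add ((continuous_id.max continuous_const).min continuous_const))
  stopped := fun t => stop_aux _ _ _ (le_max_left 0 _) t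

end Sub

open Set Filter Topology

namespace FinPath

@[ext]
lemma ext {w w' : FinPath} (hl : w.lifetime = w'.lifetime) (hf : ∀ t, w.toFun t = w'.toFun t) :
    w = w' := by
  cases w
  cases w'
  obtain rfl : _ = _ := hl
  obtain rfl : _ = _ := funext hf
  rfl

/-- The time `t` clamped to the domain `[0, ζ_(w)]` of the path. -/
def clamp (w : FinPath) (t : ℝ) : ℝ := min (max t 0) w.lifetime

lemma clamp_nonneg (w : FinPath) (t : ℝ) : 0 ≤ w.clamp t :=
  le_min (le_max_right _ _) w.lifetime_nonneg

lemma clamp_le (w : FinPath) (t : ℝ) : w.clamp t ≤ w.lifetime := min_le_right _ _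

lemma toFun_clamp (w : FinPath) (t : ℝ) : w.toFun (w.clamp t) = w.toFun t := (w.stopped t).symm

lemma toFun_of_lifetime_le (w : FinPath) {t : ℝ} (ht : w.lifetime ≤ t) : w.toFun t = w.tip := by
  rw [w.stopped, min_eq_right (ht.trans (le_max_left _ _)), tip]

lemma abs_clamp_sub_le (w w' : FinPath) (t : ℝ) :
    |w.clamp t - w'.clamp t| ≤ |w.lifetime - w'.lifetime| := by
  simpa [clamp] using abs_min_sub_min_le_max (max t 0) w.lifetime (max t 0) w'.lifetime

lemma eq_triv {w : FinPath} {x : ℝ} (hl : w.lifetime = 0) (h0 : w.toFun 0 = x) : w = triv x := by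
  refine ext hl fun t => ?_
  rw [w.stopped, hl, min_eq_right (le_max_right _ _), h0]
  rfl

lemma exists_abs_le (w : FinPath) : ∃ C, ∀ t, |w.toFun t| ≤ C := by
  obtain ⟨C, hC⟩ := (isCompact_Icc (a := 0) (b := w.lifetime)).exists_bound_of_continuousOn
    w.cont.continuousOn
  refine ⟨C, fun t => ?_⟩
  rw [← w.toFun_clamp]
  exact hC _ ⟨w.clamp_nonneg t, w.clamp_le t⟩

lemma bddAbove_abs_sub (w w' : FinPath) :
    BddAbove (range fun t => |w.toFun t - w'.toFun t|) := by
  obtain ⟨C, hC⟩ := w.exists_abs_le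
  obtain ⟨C', hC'⟩ := w'.exists_abs_le
  refine ⟨C + C', ?_⟩
  rintro _ ⟨t, rfl⟩
  exact (abs_sub _ _).trans (add_le_add (hC t) (hC' t))

lemma dW_le {w w' : FinPath} {a b : ℝ} (ha : |w.lifetime - w'.lifetime| ≤ a)
    (hb : ∀ t, |w.toFun t - w'.toFun t| ≤ b) : dW w w' ≤ a + b :=
  add_le_add ha (ciSup_le hb)

lemma abs_lifetime_add_abs_tip_le_dW (w w' : FinPath) :
    |w.lifetime - w'.lifetime| + |w.tip - w'.tip| ≤ dW w w' := by
  have h := le_ciSup (bddAbove_abs_sub w w') (max w.lifetime w'.lifetime)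
  simp only [w.toFun_of_lifetime_le (le_max_left _ _),
    w'.toFun_of_lifetime_le (le_max_right _ _)] at h
  exact add_le_add le_rfl h

end FinPath

/-- In the tree coded by `h`, the time `r ≤ s` codes the ancestor of `s` at height `u`. -/
def IsAncestor (h : ℝ → ℝ) (s u r : ℝ) : Prop :=
  r ≤ s ∧ h r = u ∧ ∀ q ∈ Icc r s, u ≤ h q

lemma exists_isAncestor_Icc {h : ℝ → ℝ} (hc : Continuous h) {a s u : ℝ} (has : a ≤ s)
    (hau : h a ≤ u) (hus : u ≤ h s) : ∃ r ∈ Icc a s, IsAncestor h s u r := by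
  have hK : IsCompact (Icc a s ∩ h ⁻¹' {u}) :=
    isCompact_Icc.inter_right (isClosed_singleton.preimage hc)
  have hne : (Icc a s ∩ h ⁻¹' {u}).Nonempty := by
    obtain ⟨r, hr, hru⟩ := intermediate_value_Icc has hc.continuousOn ⟨hau, hus⟩
    exact ⟨r, hr, hru⟩
  obtain ⟨r, ⟨hr, hru⟩, hmax⟩ := hK.exists_isGreatest hne
  refine ⟨r, hr, hr.2, hru, fun q hq => ?_⟩
  by_contra! hlt
  obtain ⟨p, hp, hpu⟩ := intermediate_value_Icc hq.2 hc.continuousOn ⟨hlt.le, hus⟩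
  have hpr : p ≤ r := hmax ⟨⟨hr.1.trans (hq.1.trans hp.1), hp.2⟩, hpu⟩
  have hqr : q = r := le_antisymm (hp.1.trans hpr) hq.1
  rw [hqr] at hlt
  exact hlt.ne hru

lemma le_on_uIcc_of_le {h : ℝ → ℝ} {s s' r r' m : ℝ} (hr : r ≤ s) (hr' : r' ≤ s')
    (h₁ : ∀ q ∈ Icc r s, m ≤ h q) (h₂ : ∀ q ∈ Icc r' s', m ≤ h q)
    (h₃ : ∀ q ∈ uIcc s s', m ≤ h q) : ∀ q ∈ uIcc r r', m ≤ h q := by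
  intro q hq
  rw [mem_uIcc] at hq
  by_cases c₁ : q ∈ Icc r s
  · exact h₁ q c₁
  by_cases c₂ : q ∈ Icc r' s'
  · exact h₂ q c₂
  refine h₃ q (mem_uIcc.2 ?_)
  simp only [mem_Icc, not_and_or, not_le] at c₁ c₂
  grind

namespace IsTreeLike

variable {h f : ℝ → ℝ}

lemma f_eq_of_le (H : IsTreeLike h f) {a b : ℝ} (ha : 0 ≤ a) (hab : a ≤ b) (he : h a = h b)
    (hle : ∀ q ∈ Icc a b, h a ≤ h q) : f a = f b := by
  refine H.treeLike a b ha hab he (IsLeast.csInf_eq ?_).symm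
  refine ⟨⟨a, left_mem_Icc.2 hab, rfl⟩, ?_⟩
  rintro _ ⟨q, hq, rfl⟩
  exact hle q hq

lemma f_eq_zero (H : IsTreeLike h f) {s : ℝ} (hs : h s = 0) : f s = f 0 := by
  rcases le_total s 0 with h0 | h0
  · exact H.f_nonpos s h0
  · have h00 := H.h_nonpos 0 le_rfl
    exact (H.f_eq_of_le le_rfl h0 (h00.trans hs.symm) fun q _ => h00.trans_le (H.nonneg q)).symm

lemma f_eq_of_uIcc (H : IsTreeLike h f) {a b : ℝ} (he : h a = h b)
    (hle : ∀ q ∈ uIcc a b, h a ≤ h q) : f a = f b := by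
  wlog hab : a ≤ b generalizing a b
  · exact (this he.symm (by rwa [uIcc_comm, ← he]) (le_of_not_ge hab)).symm
  rw [uIcc_of_le hab] at hle
  rcases le_total 0 a with ha | ha
  · exact H.f_eq_of_le ha hab he hle
  · have h0 := H.h_nonpos a ha
    rw [H.f_eq_zero h0, H.f_eq_zero (he.symm.trans h0)]

lemma exists_clamp (H : IsTreeLike h f) :
    ∃ M, 0 ≤ M ∧ ∀ s, h (min (max s 0) M) = h s ∧ f (min (max s 0) M) = f s := by
  obtain ⟨B, hB⟩ := H.finite
  have hz : ∀ s, B < s → h s = 0 := fun s hs => by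
    by_contra hne
    exact hs.not_ge (hB hne)
  refine ⟨max B 0 + 1, by positivity, fun s => ?_⟩
  have hM : B < max B 0 + 1 := (le_max_left B 0).trans_lt (lt_add_one _)
  have key : h (min (max s 0) (max B 0 + 1)) = h s ∧
      (min (max s 0) (max B 0 + 1) = s ∨ h s = 0) := by
    rcases le_total s 0 with hs | hs
    · rw [max_eq_right hs, min_eq_left (by positivity), H.h_nonpos 0 le_rfl, H.h_nonpos s hs]
      simp
    · rw [max_eq_left hs]
      rcases le_total s (max B 0 + 1) with hs' | hs'
      · simp [min_eq_left hs']
      · rw [min_eq_right hs', hz _ hM, hz _ (hM.trans_le hs')]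
        simp
  refine ⟨key.1, ?_⟩
  rcases key.2 with he | he
  · rw [he]
  · rw [H.f_eq_zero he, H.f_eq_zero (key.1.trans he)]

lemma exists_abs_le (H : IsTreeLike h f) : ∃ C, ∀ s, |h s| ≤ C ∧ |f s| ≤ C := by
  obtain ⟨M, hM, hcl⟩ := H.exists_clamp
  obtain ⟨C, hC⟩ := (isCompact_Icc (a := 0) (b := M)).exists_bound_of_continuousOn
    H.cont_h.continuousOn
  obtain ⟨C', hC'⟩ := (isCompact_Icc (a := 0) (b := M)).exists_bound_of_continuousOn
    H.cont_f.continuousOn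
  refine ⟨max C C', fun s => ?_⟩
  have hmem : min (max s 0) M ∈ Icc 0 M := ⟨le_min (le_max_right _ _) hM, min_le_right _ _⟩
  rw [← (hcl s).1, ← (hcl s).2]
  exact ⟨(hC _ hmem).trans (le_max_left _ _), (hC' _ hmem).trans (le_max_right _ _)⟩

lemma bddAbove_abs_add_abs {h' f' : ℝ → ℝ} (H : IsTreeLike h f) (H' : IsTreeLike h' f') :
    BddAbove (range fun s => |h s - h' s| + |f s - f' s|) := by
  obtain ⟨C, hC⟩ := H.exists_abs_le
  obtain ⟨C', hC'⟩ := H'.exists_abs_le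
  refine ⟨(C + C') + (C + C'), ?_⟩
  rintro _ ⟨s, rfl⟩
  exact add_le_add ((abs_sub _ _).trans (add_le_add (hC s).1 (hC' s).1))
    ((abs_sub _ _).trans (add_le_add (hC s).2 (hC' s).2))

/-- Uniform continuity of `f` for the tree pseudo-distance, on a compact time interval. -/
lemma exists_delta_Icc (H : IsTreeLike h f) (M : ℝ) {ε : ℝ} (hε : 0 < ε) :
    ∃ δ > 0, ∀ a ∈ Icc 0 M, ∀ b ∈ Icc 0 M, a ≤ b →
      (∀ q ∈ Icc a b, h a - δ ≤ h q ∧ h b - δ ≤ h q) → |f a - f b| < ε := by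
  by_contra! hcon
  choose a ha b hb hab hle hge using fun n : ℕ => hcon (1 / ((n : ℝ) + 1)) (by positivity)
  obtain ⟨⟨a₀, b₀⟩, hmem, φ, hφ, hlim⟩ := (isCompact_Icc.prod isCompact_Icc).tendsto_subseq
    (x := fun n => (a n, b n)) fun n => ⟨ha n, hb n⟩
  have hA : Tendsto (fun n => a (φ n)) atTop (𝓝 a₀) := (continuous_fst.tendsto _).comp hlim
  have hB : Tendsto (fun n => b (φ n)) atTop (𝓝 b₀) := (continuous_snd.tendsto _).comp hlim
  have hδ : Tendsto (fun n => 1 / ((φ n : ℝ) + 1)) atTop (𝓝 0) :=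
    tendsto_one_div_add_atTop_nhds_zero_nat.comp hφ.tendsto_atTop
  have hhA := (H.cont_h.tendsto a₀).comp hA
  have hhB := (H.cont_h.tendsto b₀).comp hB
  have hab₀ : a₀ ≤ b₀ := le_of_tendsto_of_tendsto' hA hB fun n => hab _
  have hAB : h a₀ ≤ h b₀ := by
    have := le_of_tendsto_of_tendsto' (hhA.sub hδ) hhB
      fun n => (hle (φ n) _ (right_mem_Icc.2 (hab _))).1
    simpa using this
  have hBA : h b₀ ≤ h a₀ := by
    have := le_of_tendsto_of_tendsto' (hhB.sub hδ) hhA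
      fun n => (hle (φ n) _ (left_mem_Icc.2 (hab _))).2
    simpa using this
  have he := le_antisymm hAB hBA
  have hf : f a₀ = f b₀ := by
    refine H.f_eq_of_le hmem.1.1 hab₀ he fun q hq => ?_
    rcases hq.1.eq_or_lt with rfl | h₁
    · exact le_rfl
    rcases hq.2.eq_or_lt with rfl | h₂
    · exact hAB
    have := le_of_tendsto (hhA.sub hδ) (b := h q) (by
      filter_upwards [hA.eventually_lt_const h₁, hB.eventually_const_lt h₂] with n hn hn'
      exact (hle (φ n) q ⟨hn.le, hn'.le⟩).1)
    simpa using this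
  have := ge_of_tendsto' (((H.cont_f.tendsto a₀).comp hA).sub
    ((H.cont_f.tendsto b₀).comp hB)).abs fun n => hge (φ n)
  rw [hf] at this
  simp only [sub_self, abs_zero] at this
  exact this.not_gt hε

/-- Uniform continuity of `f` for the tree pseudo-distance. -/
lemma exists_delta (H : IsTreeLike h f) {ε : ℝ} (hε : 0 < ε) :
    ∃ δ > 0, ∀ a b m, (∀ q ∈ uIcc a b, m ≤ h q) → h a ≤ m + δ → h b ≤ m + δ →
      |f a - f b| < ε := by
  obtain ⟨M, hM, hcl⟩ := H.exists_clamp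
  obtain ⟨δ, hδ, hmain⟩ := H.exists_delta_Icc M hε
  refine ⟨δ, hδ, fun a b m hle ha hb => ?_⟩
  wlog hab : a ≤ b generalizing a b
  · rw [abs_sub_comm]
    exact this b a (by rwa [uIcc_comm]) hb ha (le_of_not_ge hab)
  rw [uIcc_of_le hab] at hle
  have hmem : ∀ s, min (max s 0) M ∈ Icc 0 M := fun s =>
    ⟨le_min (le_max_right _ _) hM, min_le_right _ _⟩
  rw [← (hcl a).2, ← (hcl b).2]
  refine hmain _ (hmem a) _ (hmem b) (min_le_min_right _ (max_le_max_right _ hab)) fun q hq => ?_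
  obtain ⟨p, hp, rfl⟩ := intermediate_value_Icc (f := fun s => min (max s 0) M) hab
    (by fun_prop) hq
  have := hle p hp
  simp only [(hcl p).1, (hcl a).1, (hcl b).1]
  constructor <;> linarith

lemma exists_isAncestor (H : IsTreeLike h f) {s u : ℝ} (hu : 0 ≤ u) (hus : u ≤ h s) :
    ∃ r, IsAncestor h s u r := by
  obtain ⟨r, -, hr⟩ := exists_isAncestor_Icc H.cont_h (min_le_left s 0)
    ((H.h_nonpos _ (min_le_right s 0)).trans_le hu) hus
  exact ⟨r, hr⟩

lemma f_eq_of_isAncestor (H : IsTreeLike h f) {s s' u r r' : ℝ} (hr : IsAncestor h s u r)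
    (hr' : IsAncestor h s' u r') (hle : ∀ q ∈ uIcc s s', u ≤ h q) : f r = f r' :=
  H.f_eq_of_uIcc (hr.2.1.trans hr'.2.1.symm)
    (hr.2.1 ▸ le_on_uIcc_of_le hr.1 hr'.1 hr.2.2 hr'.2.2 hle)

/-- The ancestor of `s` at height `u` clamped to `[0, h s]`. -/
noncomputable def anc (H : IsTreeLike h f) (s t : ℝ) : ℝ :=
  (H.exists_isAncestor (le_min (le_max_right t 0) (H.nonneg s)) (min_le_right _ (h s))).choose

lemma isAncestor_anc (H : IsTreeLike h f) (s t : ℝ) :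
    IsAncestor h s (min (max t 0) (h s)) (H.anc s t) :=
  (H.exists_isAncestor (le_min (le_max_right t 0) (H.nonneg s)) (min_le_right _ (h s))).choose_spec

lemma continuous_f_anc (H : IsTreeLike h f) (s : ℝ) : Continuous fun t => f (H.anc s t) := by
  refine Metric.continuous_iff.2 fun t ε hε => ?_
  obtain ⟨δ, hδ, hmain⟩ := H.exists_delta hε
  refine ⟨δ, hδ, fun t' ht' => ?_⟩
  have h₁ := H.isAncestor_anc s t
  have h₂ := H.isAncestor_anc s t'
  have hd : |min (max t' 0) (h s) - min (max t 0) (h s)| < δ := by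
    refine lt_of_le_of_lt ?_ ht'
    refine (abs_min_sub_min_le_max _ _ _ _).trans ?_
    simpa [Real.dist_eq] using abs_max_sub_max_le_abs t' t 0
  rw [abs_lt] at hd
  refine hmain _ _ (min (min (max t' 0) (h s)) (min (max t 0) (h s)))
    (le_on_uIcc_of_le h₂.1 h₁.1 (fun q hq => (min_le_left _ _).trans (h₂.2.2 q hq))
      (fun q hq => (min_le_right _ _).trans (h₁.2.2 q hq)) fun q hq => ?_) ?_ ?_
  · obtain rfl : q = s := by simpa using hq
    exact (min_le_left _ _).trans (min_le_right _ _)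
  · rw [h₂.2.1, ← sub_le_iff_le_add]
    exact le_min (by linarith) (by linarith)
  · rw [h₁.2.1, ← sub_le_iff_le_add]
    exact le_min (by linarith) (by linarith)

/-- The snake trajectory coded by a tree-like path. -/
noncomputable def snake (H : IsTreeLike h f) (s : ℝ) : FinPath where
  lifetime := h s
  lifetime_nonneg := H.nonneg s
  toFun t := f (H.anc s t)
  cont := H.continuous_f_anc s
  stopped t := by
    have h₁ := H.isAncestor_anc s t
    have h₂ := H.isAncestor_anc s (min (max t 0) (h s))
    rw [max_eq_left (le_min (le_max_right t 0) (H.nonneg s)), min_assoc, min_self] at h₂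
    refine H.f_eq_of_isAncestor h₁ h₂ fun q hq => ?_
    obtain rfl : q = s := by simpa using hq
    exact min_le_right _ _

lemma snake_tip (H : IsTreeLike h f) (s : ℝ) : (H.snake s).tip = f s := by
  have h₁ := H.isAncestor_anc s (h s)
  rw [max_eq_left (H.nonneg s), min_self] at h₁
  change f (H.anc s (h s)) = f s
  refine H.f_eq_of_uIcc h₁.2.1 ?_
  rw [uIcc_of_le h₁.1]
  exact fun q hq => h₁.2.1.trans_le (h₁.2.2 q hq)

lemma snake_zero (H : IsTreeLike h f) (s : ℝ) : (H.snake s).toFun 0 = f 0 := by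
  refine H.f_eq_zero ((H.isAncestor_anc s 0).2.1.trans ?_)
  rw [max_self, min_eq_left (H.nonneg s)]

lemma snake_eq_triv (H : IsTreeLike h f) {s : ℝ} (hs : h s = 0) :
    H.snake s = FinPath.triv (f 0) :=
  FinPath.eq_triv hs (H.snake_zero s)

lemma snake_continuous (H : IsTreeLike h f) (s : ℝ) {ε : ℝ} (hε : 0 < ε) :
    ∃ δ > 0, ∀ s', |s' - s| < δ → FinPath.dW (H.snake s') (H.snake s) < ε := by
  obtain ⟨η, hη, hmain⟩ := H.exists_delta (half_pos (half_pos hε))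
  obtain ⟨δ, hδ, hh⟩ := Metric.continuous_iff.1 H.cont_h s (min (η / 2) (ε / 4))
    (by positivity)
  refine ⟨δ, hδ, fun s' hs' => ?_⟩
  have hnear : ∀ q ∈ uIcc s' s, |h q - h s| < min (η / 2) (ε / 4) := fun q hq =>
    by
    refine hh q (lt_of_le_of_lt ?_ hs')
    rw [Real.dist_eq, abs_sub_comm, abs_sub_comm s']
    exact abs_sub_right_of_mem_uIcc hq
  have hs := hnear s' left_mem_uIcc
  refine (FinPath.dW_le (a := ε / 4) (b := ε / 2 / 2)
    (hs.le.trans (min_le_right _ _)) fun t => ?_).trans_lt (by linarith)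
  have h₁ := H.isAncestor_anc s' t
  have h₂ := H.isAncestor_anc s t
  have hcl := (H.snake s').abs_clamp_sub_le (H.snake s) t
  change |min (max t 0) (h s') - min (max t 0) (h s)| ≤ |h s' - h s| at hcl
  have hcl' := abs_le.1 (hcl.trans (hs.le.trans (min_le_left _ _)))
  have hus := min_le_right (max t 0) (h s)
  refine (hmain _ _ (min (max t 0) (h s) - η / 2)
    (le_on_uIcc_of_le h₁.1 h₂.1 (fun q hq => ?_) (fun q hq => ?_) fun q hq => ?_) ?_ ?_).le
  · linarith [h₁.2.2 q hq]
  · linarith [h₂.2.2 q hq]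
  · linarith [(abs_lt.1 ((hnear q hq).trans_le (min_le_left _ _))).1]
  · rw [h₁.2.1]
    linarith
  · rw [h₂.2.1]
    linarith

lemma isSnakeTraj_snake (H : IsTreeLike h f) : IsSnakeTraj (f 0) H.snake where
  init s hs := H.snake_eq_triv (H.h_nonpos s hs)
  start := H.snake_zero
  cont s _ hε := H.snake_continuous s hε
  finite := H.finite.mono fun _ hs hz => hs (H.snake_eq_triv hz)
  snake s s' _ hss' t ht hle := by
    have hq : ∀ q ∈ Icc s s', t ≤ h q := fun q hq => hle.trans <|
      csInf_le ⟨0, by rintro _ ⟨r, -, rfl⟩; exact H.nonneg r⟩ ⟨q, hq, rfl⟩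
    have h₁ := H.isAncestor_anc s t
    have h₂ := H.isAncestor_anc s' t
    rw [max_eq_left ht, min_eq_left (hq s (left_mem_Icc.2 hss'))] at h₁
    rw [max_eq_left ht, min_eq_left (hq s' (right_mem_Icc.2 hss'))] at h₂
    exact H.f_eq_of_isAncestor h₁ h₂ (by rwa [uIcc_of_le hss'])

end IsTreeLike

namespace IsSnakeTraj

variable {x : ℝ} {ω : ℝ → FinPath}

lemma eq_triv_iff (H : IsSnakeTraj x ω) (s : ℝ) :
    ω s = FinPath.triv x ↔ (ω s).lifetime = 0 :=
  ⟨fun h => by rw [h]; rfl, fun h => FinPath.eq_triv h (H.start s)⟩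

lemma toFun_eq_of_le (H : IsSnakeTraj x ω) {s s' t : ℝ} (hs : 0 ≤ s) (hss' : s ≤ s')
    (ht : 0 ≤ t) (hle : ∀ q ∈ Icc s s', t ≤ (ω q).lifetime) :
    (ω s).toFun t = (ω s').toFun t := by
  refine H.snake s s' hs hss' t ht (le_csInf ((nonempty_Icc.2 hss').image _) ?_)
  rintro _ ⟨q, hq, rfl⟩
  exact hle q hq

lemma isTreeLike (H : IsSnakeTraj x ω) :
    IsTreeLike (fun s => (ω s).lifetime) (fun s => (ω s).tip) where
  cont_h := Metric.continuous_iff.2 fun s ε hε => by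
    obtain ⟨δ, hδ, hs⟩ := H.cont s ε hε
    exact ⟨δ, hδ, fun s' hs' => (le_of_add_le_of_nonneg_left
      ((ω s').abs_lifetime_add_abs_tip_le_dW (ω s)) (abs_nonneg _)).trans_lt (hs s' hs')⟩
  cont_f := Metric.continuous_iff.2 fun s ε hε => by
    obtain ⟨δ, hδ, hs⟩ := H.cont s ε hε
    exact ⟨δ, hδ, fun s' hs' => (le_of_add_le_of_nonneg_right
      ((ω s').abs_lifetime_add_abs_tip_le_dW (ω s)) (abs_nonneg _)).trans_lt (hs s' hs')⟩
  nonneg s := (ω s).lifetime_nonneg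
  h_nonpos s hs := (H.eq_triv_iff s).1 (H.init s hs)
  f_nonpos s hs := by rw [H.init s hs, H.init 0 le_rfl]
  finite := H.finite.mono fun s hs he => hs ((H.eq_triv_iff s).1 he)
  treeLike s s' hs hss' he hmin := by
    have := H.snake s s' hs hss' (ω s).lifetime (ω s).lifetime_nonneg hmin.le
    simp only [FinPath.tip]
    rw [this, he]

/-- The path `ω_s` at time `t` is the tip of the path at an ancestor of `s`. -/
lemma toFun_eq_tip (H : IsSnakeTraj x ω) {s t r : ℝ} (ht : 0 ≤ t)
    (hr : IsAncestor (fun s => (ω s).lifetime) s t r) : (ω s).toFun t = (ω r).tip := by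
  have hts : t ≤ (ω s).lifetime := hr.2.2 s (right_mem_Icc.2 hr.1)
  have h00 := H.isTreeLike.h_nonpos 0 le_rfl
  rcases le_total 0 r with h0 | h0
  · rw [← H.toFun_eq_of_le h0 hr.1 ht hr.2.2]
    exact (ω r).toFun_of_lifetime_le hr.2.1.le
  · have hrl := H.isTreeLike.h_nonpos r h0
    obtain rfl : t = 0 := hr.2.1.symm.trans hrl
    rw [H.start, FinPath.tip, hrl, H.start]

lemma exists_isAncestor_clamp (H : IsSnakeTraj x ω) (s t : ℝ) :
    ∃ r, IsAncestor (fun s => (ω s).lifetime) s ((ω s).clamp t) r ∧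
      (ω s).toFun t = (ω r).tip := by
  obtain ⟨r, hr⟩ := H.isTreeLike.exists_isAncestor ((ω s).clamp_nonneg t) ((ω s).clamp_le t)
  exact ⟨r, hr, by rw [← (ω s).toFun_clamp, H.toFun_eq_tip ((ω s).clamp_nonneg t) hr]⟩

lemma eq_of_lifetime_of_tip {x' : ℝ} {ω' : ℝ → FinPath} (H : IsSnakeTraj x ω)
    (H' : IsSnakeTraj x' ω') (hl : ∀ s, (ω s).lifetime = (ω' s).lifetime)
    (ht : ∀ s, (ω s).tip = (ω' s).tip) : ω = ω' := by
  refine funext fun s => FinPath.ext (hl s) fun t => ?_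
  obtain ⟨r, hr, he⟩ := H.exists_isAncestor_clamp s t
  have hcl : (ω s).clamp t = (ω' s).clamp t := by simp only [FinPath.clamp, hl]
  simp only [hl, hcl] at hr
  rw [he, ht, ← (ω' s).toFun_clamp, H'.toFun_eq_tip ((ω' s).clamp_nonneg t) hr]

lemma sigmaTraj_eq (H : IsSnakeTraj x ω) :
    sigmaTraj ω = sigmaH (fun s => (ω s).lifetime) := by
  simp only [sigmaTraj, sigmaH, H.init 0 le_rfl, ne_eq, H.eq_triv_iff]

lemma bddAbove_dW {x' : ℝ} {ω' : ℝ → FinPath} (H : IsSnakeTraj x ω) (H' : IsSnakeTraj x' ω') :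
    BddAbove (range fun s => FinPath.dW (ω s) (ω' s)) := by
  obtain ⟨C, hC⟩ := H.isTreeLike.exists_abs_le
  obtain ⟨C', hC'⟩ := H'.isTreeLike.exists_abs_le
  refine ⟨(C + C') + (C + C'), ?_⟩
  rintro _ ⟨s, rfl⟩
  refine FinPath.dW_le ((abs_sub _ _).trans (add_le_add (hC s).1 (hC' s).1)) fun t => ?_
  obtain ⟨r, -, hr⟩ := H.exists_isAncestor_clamp s t
  obtain ⟨r', -, hr'⟩ := H'.exists_isAncestor_clamp s t
  rw [hr, hr']
  exact (abs_sub _ _).trans (add_le_add (hC r).2 (hC' r').2)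

lemma dT_le_dS {x' : ℝ} {ω' : ℝ → FinPath} (H : IsSnakeTraj x ω) (H' : IsSnakeTraj x' ω') :
    dT (fun s => (ω s).lifetime) (fun s => (ω s).tip)
      (fun s => (ω' s).lifetime) (fun s => (ω' s).tip) ≤ dS ω ω' := by
  rw [dT, dS, H.sigmaTraj_eq, H'.sigmaTraj_eq]
  exact add_le_add le_rfl (ciSup_mono (H.bddAbove_dW H') fun s =>
    (ω s).abs_lifetime_add_abs_tip_le_dW (ω' s))

/-- A modulus of continuity for the inverse map at a snake trajectory. -/
lemma exists_delta_dS (H : IsSnakeTraj x ω) {ε : ℝ} (hε : 0 < ε) :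
    ∃ δ > 0, ∀ (x' : ℝ) (ω' : ℝ → FinPath), IsSnakeTraj x' ω' →
      dT (fun s => (ω s).lifetime) (fun s => (ω s).tip)
        (fun s => (ω' s).lifetime) (fun s => (ω' s).tip) < δ → dS ω ω' < ε := by
  obtain ⟨η, hη, hmain⟩ := H.isTreeLike.exists_delta (ε := ε / 8) (by positivity)
  refine ⟨min (η / 4) (ε / 8), by positivity, fun x' ω' H' hd => ?_⟩
  set δ := min (η / 4) (ε / 8)
  have hδη : δ ≤ η / 4 := min_le_left _ _
  have hδε : δ ≤ ε / 8 := min_le_right _ _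
  rw [dT, ← H.sigmaTraj_eq, ← H'.sigmaTraj_eq] at hd
  have hsup := fun s => le_ciSup (H.isTreeLike.bddAbove_abs_add_abs H'.isTreeLike) s
  have hl : ∀ s, |(ω s).lifetime - (ω' s).lifetime| ≤ δ := fun s => by
    linarith [hsup s, abs_nonneg ((ω s).tip - (ω' s).tip),
      abs_nonneg (sigmaTraj ω - sigmaTraj ω')]
  have ht : ∀ s, |(ω s).tip - (ω' s).tip| ≤ δ := fun s => by
    linarith [hsup s, abs_nonneg ((ω s).lifetime - (ω' s).lifetime),
      abs_nonneg (sigmaTraj ω - sigmaTraj ω')]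
  have hσ : |sigmaTraj ω - sigmaTraj ω'| ≤ δ := by
    linarith [hsup 0, abs_nonneg ((ω 0).lifetime - (ω' 0).lifetime),
      abs_nonneg ((ω 0).tip - (ω' 0).tip)]
  have hW : ∀ s, FinPath.dW (ω s) (ω' s) ≤ δ + (ε / 8 + δ) := fun s => by
    refine FinPath.dW_le (hl s) fun t => ?_
    obtain ⟨r, hr, hrt⟩ := H.exists_isAncestor_clamp s t
    obtain ⟨r', hr', hrt'⟩ := H'.exists_isAncestor_clamp s t
    have hcl := abs_le.1 (((ω s).abs_clamp_sub_le (ω' s) t).trans (hl s))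
    have hr'eq : (ω' r').lifetime = (ω' s).clamp t := hr'.2.1
    have hclose : |(ω r).tip - (ω r').tip| < ε / 8 := by
      refine hmain r r' ((ω s).clamp t - 2 * δ)
        (le_on_uIcc_of_le hr.1 hr'.1 (fun q hq => ?_) (fun q hq => ?_) fun q hq => ?_) ?_ ?_
      · linarith [hr.2.2 q hq, abs_nonneg ((ω s).lifetime - (ω' s).lifetime), hl s]
      · linarith [hr'.2.2 q hq, (abs_le.1 (hl q)).1]
      · obtain rfl : q = s := by simpa using hq
        linarith [(ω q).clamp_le t, abs_nonneg ((ω q).lifetime - (ω' q).lifetime), hl q]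
      · linarith [hr.2.1]
      · linarith [(abs_le.1 (hl r')).2]
    rw [hrt, hrt']
    exact (abs_sub_le _ (ω r').tip _).trans (add_le_add hclose.le (ht r'))
  have := ciSup_le hW
  rw [dS]
  linarith

end IsSnakeTraj

/-- **Marckert–Mokkadem homeomorphism theorem.** The map `Δ : ω ↦ (h, f)`, where
`h(s) = ζ_s(ω)` is the lifetime of `ω_s` and `f(s) = ω̂_s` is its endpoint, is a
bijection from the set of all snake trajectories onto the set of all tree-like
paths; both `Δ` and `Δ⁻¹` are continuous for the distances `d_S` and `d_T`;
moreover if `Δ(ω) = (h, f)` then `σ(ω) = σ_h`. -/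
theorem marckertMokkadem :
    -- `Δ` maps snake trajectories to tree-like paths
    (∀ (x : ℝ) (ω : ℝ → FinPath), IsSnakeTraj x ω →
      IsTreeLike (fun s => (ω s).lifetime) (fun s => (ω s).tip)) ∧
    -- `Δ` is injective
    (∀ (x x' : ℝ) (ω ω' : ℝ → FinPath), IsSnakeTraj x ω → IsSnakeTraj x' ω' →
      (∀ s, (ω s).lifetime = (ω' s).lifetime) → (∀ s, (ω s).tip = (ω' s).tip) →
      ω = ω') ∧
    -- `Δ` is surjective onto tree-like paths
    (∀ h f : ℝ → ℝ, IsTreeLike h f → ∃ ω : ℝ → FinPath, IsSnakeTraj (f 0) ω ∧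
      (∀ s, (ω s).lifetime = h s) ∧ (∀ s, (ω s).tip = f s)) ∧
    -- `σ(ω) = σ_h` when `Δ(ω) = (h, f)`
    (∀ (x : ℝ) (ω : ℝ → FinPath), IsSnakeTraj x ω →
      sigmaTraj ω = sigmaH (fun s => (ω s).lifetime)) ∧
    -- `Δ` is continuous for `d_S` and `d_T`
    (∀ (x : ℝ) (ω : ℝ → FinPath), IsSnakeTraj x ω → ∀ ε > (0:ℝ), ∃ δ > (0:ℝ),
      ∀ (x' : ℝ) (ω' : ℝ → FinPath), IsSnakeTraj x' ω' → dS ω ω' < δ →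
        dT (fun s => (ω s).lifetime) (fun s => (ω s).tip)
           (fun s => (ω' s).lifetime) (fun s => (ω' s).tip) < ε) ∧
    -- `Δ⁻¹` is continuous for `d_T` and `d_S`
    (∀ (x : ℝ) (ω : ℝ → FinPath), IsSnakeTraj x ω → ∀ ε > (0:ℝ), ∃ δ > (0:ℝ),
      ∀ (x' : ℝ) (ω' : ℝ → FinPath), IsSnakeTraj x' ω' →
        dT (fun s => (ω s).lifetime) (fun s => (ω s).tip)
           (fun s => (ω' s).lifetime) (fun s => (ω' s).tip) < δ →
        dS ω ω' < ε) := by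
  refine ⟨fun _ _ H => H.isTreeLike, fun _ _ _ _ H H' => H.eq_of_lifetime_of_tip H',
    fun h f H => ⟨H.snake, H.isSnakeTraj_snake, fun _ => rfl, H.snake_tip⟩,
    fun _ _ H => H.sigmaTraj_eq, fun _ _ H ε hε => ⟨ε, hε, fun _ _ H' hd => ?_⟩,
    fun _ _ H _ hε => H.exists_delta_dS hε⟩
  exact (H.dT_le_dS H').trans_lt hd
end

section
/- Let x ∈ ℝ and let ω : [0,∞) → W_x be a map such that the lifetime function s ↦ ζ_(ω_s) and the tip function s ↦ ω̂_s are both continuous, and such that the snake property holds: for every 0 ≤ s ≤ s', ω_s(t) = ω_{s'}(t) for every 0 ≤ t ≤ min_{s ≤ r ≤ s'} ζ_(ω_r). Then the map s ↦ ω_s is continuous from [0,∞) to (W_x, d_W). -/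
open MeasureTheory

/-- A path is frozen at its tip after its lifetime. -/
lemma FinPath.toFun_of_lifetime_le_s8 (w : FinPath) {t : ℝ} (ht : w.lifetime ≤ t) :
    w.toFun t = w.tip := by
  rw [w.stopped t, FinPath.tip, min_eq_right (ht.trans (le_max_left t 0))]

/-- A path is constant at negative times. -/
lemma FinPath.toFun_of_nonpos (w : FinPath) {t : ℝ} (ht : t ≤ 0) :
    w.toFun t = w.toFun 0 := by
  rw [w.stopped t, w.stopped 0, max_eq_right ht, max_self]

/-- If a continuous function is below the level `t` at `c` and above it at `b`, then it takes the
value `t` at a point between `c` and `b` after which it stays above `t` up to `b`. -/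
lemma exists_last_crossing {f : ℝ → ℝ} {b c t : ℝ} (hf : ContinuousOn f (Set.uIcc c b))
    (hc : f c ≤ t) (hb : t ≤ f b) :
    ∃ r ∈ Set.uIcc c b, f r = t ∧ ∀ u ∈ Set.uIcc r b, t ≤ f u := by
  have hcomp : IsCompact (Set.uIcc c b ∩ f ⁻¹' {t}) :=
    isCompact_uIcc.of_isClosed_subset
      (hf.preimage_isClosed_of_isClosed isCompact_uIcc.isClosed isClosed_singleton)
      Set.inter_subset_left
  have hne : (Set.uIcc c b ∩ f ⁻¹' {t}).Nonempty := by
    obtain ⟨r, hr, hrt⟩ := intermediate_value_uIcc hf (Set.mem_uIcc_of_le hc hb)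
    exact ⟨r, hr, hrt⟩
  obtain ⟨r, ⟨hr, hrt⟩, hmin⟩ := hcomp.exists_isMinOn hne
    (f := fun r => |r - b|) (by fun_prop)
  refine ⟨r, hr, hrt, fun u hu => ?_⟩
  by_contra! hlt
  have hucb : u ∈ Set.uIcc c b := Set.uIcc_subset_uIcc hr Set.right_mem_uIcc hu
  have hsub : Set.uIcc u b ⊆ Set.uIcc c b := Set.uIcc_subset_uIcc hucb Set.right_mem_uIcc
  obtain ⟨v, hv, hvt⟩ :=
    intermediate_value_uIcc (hf.mono hsub) (Set.mem_uIcc_of_le hlt.le hb)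
  have hle : |r - b| ≤ |v - b| := hmin ⟨hsub hv, hvt⟩
  have huv : v = u := by
    rcases Set.mem_uIcc.1 hu with ⟨h1, h2⟩ | ⟨h1, h2⟩ <;>
    rcases Set.mem_uIcc.1 hv with ⟨h3, h4⟩ | ⟨h3, h4⟩ <;>
    grind
  exact hlt.ne (huv ▸ hvt)

/-- Under the snake property, two paths agree up to any time not exceeding the lifetimes
in between, whatever the order of the two indices. -/
lemma snake_eq_of_forall_le {ω : ℝ → FinPath}
    (hsnake : ∀ s s' : ℝ, 0 ≤ s → s ≤ s' → ∀ t : ℝ, 0 ≤ t →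
      t ≤ sInf ((fun r => (ω r).lifetime) '' Set.Icc s s') →
      (ω s).toFun t = (ω s').toFun t)
    {a b t : ℝ} (ha : 0 ≤ a) (hb : 0 ≤ b) (ht : 0 ≤ t)
    (hle : ∀ r ∈ Set.uIcc a b, t ≤ (ω r).lifetime) :
    (ω a).toFun t = (ω b).toFun t := by
  rcases le_total a b with hab | hab
  · rw [Set.uIcc_of_le hab] at hle
    exact hsnake a b ha hab t ht
      (le_csInf ((Set.nonempty_Icc.2 hab).image _) (Set.forall_mem_image.2 hle))
  · rw [Set.uIcc_of_ge hab] at hle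
    exact (hsnake b a hb hab t ht
      (le_csInf ((Set.nonempty_Icc.2 hab).image _) (Set.forall_mem_image.2 hle))).symm

/-- Under the snake property, past the lifetime of some intermediate path, the values of `ω b` are
tips of intermediate paths. -/
lemma snake_exists_tip_eq {ω : ℝ → FinPath}
    (hlife : ContinuousOn (fun s => (ω s).lifetime) (Set.Ici (0:ℝ)))
    (hsnake : ∀ s s' : ℝ, 0 ≤ s → s ≤ s' → ∀ t : ℝ, 0 ≤ t →
      t ≤ sInf ((fun r => (ω r).lifetime) '' Set.Icc s s') →
      (ω s).toFun t = (ω s').toFun t)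
    {b c t : ℝ} (hb : 0 ≤ b) (hc : 0 ≤ c) (hct : (ω c).lifetime ≤ t) :
    ∃ r ∈ Set.uIcc c b, (ω b).toFun t = (ω r).tip := by
  rcases le_total (ω b).lifetime t with hbt | hbt
  · exact ⟨b, Set.right_mem_uIcc, (ω b).toFun_of_lifetime_le_s8 hbt⟩
  · obtain ⟨r, hr, hrt, hle⟩ := exists_last_crossing
      (hlife.mono fun u hu => (le_min hc hb).trans hu.1) hct hbt
    refine ⟨r, hr, ?_⟩
    rw [← snake_eq_of_forall_le hsnake ((le_min hc hb).trans hr.1) hb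
      ((ω c).lifetime_nonneg.trans hct) hle]
    exact (ω r).toFun_of_lifetime_le_s8 hrt.le

/-- **A continuity criterion for snakes.** Let `ω : [0,∞) → W_x` be such that the
lifetime function `s ↦ ζ_(ω_s)` and the tip function `s ↦ ω̂_s` are continuous, and
the snake property holds. Then `s ↦ ω_s` is continuous from `[0,∞)` to `(W_x, d_W)`. -/
theorem snake_continuous_of_lifetime_tip_continuous
    (x : ℝ) (ω : ℝ → FinPath)
    (hstart : ∀ s : ℝ, 0 ≤ s → (ω s).toFun 0 = x)
    (hlife : ContinuousOn (fun s => (ω s).lifetime) (Set.Ici (0:ℝ)))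
    (htip : ContinuousOn (fun s => (ω s).tip) (Set.Ici (0:ℝ)))
    (hsnake : ∀ s s' : ℝ, 0 ≤ s → s ≤ s' → ∀ t : ℝ, 0 ≤ t →
      t ≤ sInf ((fun r => (ω r).lifetime) '' Set.Icc s s') →
      (ω s).toFun t = (ω s').toFun t) :
    ∀ s : ℝ, 0 ≤ s → ∀ ε > (0:ℝ), ∃ δ > (0:ℝ), ∀ s' : ℝ, 0 ≤ s' →
      |s' - s| < δ → FinPath.dW (ω s') (ω s) < ε := by
  intro s hs ε hε
  have hε4 : 0 < ε / 4 := by positivity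
  obtain ⟨δ₁, hδ₁, hosc⟩ :=
    Metric.continuous_iff.1 (ω s).cont (ω s).lifetime (ε / 4) hε4
  obtain ⟨δ₂, hδ₂, hlife_near⟩ :=
    Metric.continuousOn_iff.1 hlife s hs (min δ₁ (ε / 4)) (lt_min hδ₁ hε4)
  obtain ⟨δ₃, hδ₃, htip_near⟩ := Metric.continuousOn_iff.1 htip s hs (ε / 4) hε4
  simp only [Real.dist_eq] at hosc hlife_near htip_near
  refine ⟨min δ₂ δ₃, lt_min hδ₂ hδ₃, fun s' hs' hss' => ?_⟩
  have hbetween : ∀ r ∈ Set.uIcc s s', 0 ≤ r ∧ |r - s| < min δ₂ δ₃ := fun r hr =>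
    ⟨(le_min hs hs').trans hr.1, (Set.abs_sub_left_of_mem_uIcc hr).trans_lt hss'⟩
  have hsup : ⨆ t : ℝ, |(ω s').toFun t - (ω s).toFun t| ≤ ε / 2 := by
    refine ciSup_le fun t => ?_
    by_cases heq : (ω s).toFun t = (ω s').toFun t
    · rw [heq, sub_self, abs_zero]
      positivity
    have ht : 0 ≤ t := by
      by_contra! ht
      exact heq (by rw [FinPath.toFun_of_nonpos _ ht.le, FinPath.toFun_of_nonpos _ ht.le,
        hstart s hs, hstart s' hs'])
    obtain ⟨c, hc, hct⟩ : ∃ c ∈ Set.uIcc s s', (ω c).lifetime < t := by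
      by_contra! hle
      exact heq (snake_eq_of_forall_le hsnake hs hs' ht hle)
    obtain ⟨r, hr, hrt⟩ := snake_exists_tip_eq hlife hsnake hs' (hbetween c hc).1 hct.le
    have hr' := hbetween r (Set.uIcc_subset_uIcc hc Set.right_mem_uIcc hr)
    have h1 : |(ω r).tip - (ω s).tip| < ε / 4 :=
      htip_near r hr'.1 (hr'.2.trans_le (min_le_right _ _))
    have h2 : |(ω s).toFun t - (ω s).tip| < ε / 4 := by
      rcases le_total (ω s).lifetime t with hst | hst
      · rwa [(ω s).toFun_of_lifetime_le_s8 hst, sub_self, abs_zero]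
      · refine hosc t ?_
        have hcs := (hlife_near c (hbetween c hc).1
          ((hbetween c hc).2.trans_le (min_le_left _ _))).trans_le (min_le_left _ _)
        rw [abs_lt] at hcs ⊢
        constructor <;> linarith [hcs.1]
    rw [hrt]
    rw [abs_lt] at h1 h2
    rw [abs_le]
    constructor <;> linarith [h1.1, h1.2, h2.1, h2.2]
  have hlt : |(ω s').lifetime - (ω s).lifetime| < ε / 4 :=
    (hlife_near s' hs' (hss'.trans_le (min_le_left _ _))).trans_le (min_le_right _ _)
  rw [FinPath.dW]
  linarith
end

section
/- Let h : [0,∞) → [0,∞) be continuous with h(0) = 0 and compact support. Then the kernel K(s,t) = min_{r ∈ [s∧t, s∨t]} h(r) is positive semidefinite: for every n ≥ 1, all s₁, …, s_n ≥ 0 and all real c₁, …, c_n, one has ∑_{i=1}^n ∑_{j=1}^n c_i c_j K(s_i, s_j) ≥ 0. (Hence K is the covariance function of a centered Gaussian process, the snake driven by h.) -/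
open scoped NNReal

/-- The indicator of a symmetric transitive relation on a finite type is positive semidefinite. -/
theorem sum_mul_indicator_nonneg_of_symm_trans {ι : Type*} [Fintype ι] (R : ι → ι → Prop)
    [∀ i j, Decidable (R i j)] (hsymm : ∀ i j, R i j → R j i)
    (htrans : ∀ i j k, R i j → R j k → R i k) (c : ι → ℝ) :
    0 ≤ ∑ i, ∑ j, c i * c j * (if R i j then 1 else 0) := by
  classical
  let f : ι → Finset ι := fun i => Finset.univ.filter (R i)
  let d : Finset ι → ι → ℝ := fun A i => if R i i ∧ f i = A then c i else 0
  have key : ∀ i j, c i * c j * (if R i j then 1 else 0) = ∑ A, d A i * d A j := by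
    intro i j
    have hiff : R i j ↔ R i i ∧ R j j ∧ f i = f j := by
      constructor
      · intro hij
        have hji := hsymm i j hij
        refine ⟨htrans i j i hij hji, htrans j i j hji hij, ?_⟩
        ext k
        simp only [f, Finset.mem_filter, Finset.mem_univ, true_and]
        exact ⟨htrans j i k hji, htrans i j k hij⟩
      · rintro ⟨-, hj, hf⟩
        have : j ∈ f i := by rw [hf]; simpa [f] using hj
        simpa [f] using this
    rw [Finset.sum_eq_single (f i)]
    · by_cases hi : R i i <;> by_cases hj : R j j <;> by_cases hf : f i = f j <;>
        simp [d, hiff, hi, hj, hf, eq_comm]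
    · intro A _ hA
      simp [d, hA.symm]
    · simp
  calc 0 ≤ ∑ A, (∑ i, d A i) * ∑ j, d A j := Finset.sum_nonneg fun _ _ => mul_self_nonneg _
    _ = ∑ i, ∑ j, c i * c j * (if R i j then 1 else 0) := by
      simp_rw [key, Finset.sum_mul_sum]
      rw [Finset.sum_comm]
      exact Finset.sum_congr rfl fun i _ => Finset.sum_comm

/-- A nonnegative symmetric kernel satisfying the ultrametric inequality
`min (K i j) (K j k) ≤ K i k` is positive semidefinite. -/
theorem sum_mul_kernel_nonneg_of_min_le {ι : Type*} [Fintype ι] (K : ι → ι → ℝ)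
    (hnonneg : ∀ i j, 0 ≤ K i j) (hsymm : ∀ i j, K i j = K j i)
    (hmin : ∀ i j k, min (K i j) (K j k) ≤ K i k) (c : ι → ℝ) :
    0 ≤ ∑ i, ∑ j, c i * c j * K i j := by
  have hK : ∀ i j, K i j = ∫ u, (Set.Ioo 0 (K i j)).indicator (1 : ℝ → ℝ) u := by
    intro i j
    rw [MeasureTheory.integral_indicator_one measurableSet_Ioo]
    simp [hnonneg i j]
  have hint : ∀ i j, MeasureTheory.Integrable
      (fun u => c i * c j * (Set.Ioo 0 (K i j)).indicator (1 : ℝ → ℝ) u) := by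
    intro i j
    refine MeasureTheory.Integrable.const_mul ?_ _
    rw [MeasureTheory.integrable_indicator_iff measurableSet_Ioo]
    exact MeasureTheory.integrableOn_const (by simp)
  have hsum : ∑ i, ∑ j, c i * c j * K i j =
      ∫ u, ∑ i, ∑ j, c i * c j * (Set.Ioo 0 (K i j)).indicator (1 : ℝ → ℝ) u := by
    rw [MeasureTheory.integral_finsetSum _ fun i _ =>
      MeasureTheory.integrable_finsetSum _ fun j _ => hint i j]
    refine Finset.sum_congr rfl fun i _ => ?_
    rw [MeasureTheory.integral_finsetSum _ fun j _ => hint i j]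
    refine Finset.sum_congr rfl fun j _ => ?_
    rw [MeasureTheory.integral_const_mul, ← hK]
  rw [hsum]
  refine MeasureTheory.integral_nonneg fun u => ?_
  classical
  simp only [Set.indicator_apply, Pi.one_apply]
  refine sum_mul_indicator_nonneg_of_symm_trans (fun i j => u ∈ Set.Ioo 0 (K i j)) ?_ ?_ c
  · intro i j hij
    rwa [hsymm j i]
  · intro i j k hij hjk
    exact ⟨hij.1, (lt_min hij.2 hjk.2).trans_le (hmin i j k)⟩

/-- For `h : [0,∞) → [0,∞)` continuous with `h 0 = 0` and compact support, the kernel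
`K(s,t) = min_{r ∈ [s∧t, s∨t]} h(r)` is positive semidefinite (hence it is the
covariance function of a centered Gaussian process, the snake driven by `h`). -/
theorem treeKernel_posSemidef (h : ℝ≥0 → ℝ)
    (hcont : Continuous h) (h0 : h 0 = 0) (hsupp : HasCompactSupport h)
    (hnonneg : ∀ x, 0 ≤ h x) :
    ∀ (n : ℕ) (s : Fin n → ℝ≥0) (c : Fin n → ℝ),
      0 ≤ ∑ i, ∑ j, c i * c j * sInf (h '' Set.uIcc (s i) (s j)) := by
  intro n s c
  have hbdd : ∀ S : Set ℝ≥0, BddBelow (h '' S) := fun S =>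
    ⟨0, by rintro _ ⟨x, -, rfl⟩; exact hnonneg x⟩
  refine sum_mul_kernel_nonneg_of_min_le (fun i j => sInf (h '' Set.uIcc (s i) (s j))) ?_ ?_ ?_ c
  · intro i j
    refine Real.sInf_nonneg ?_
    rintro _ ⟨x, -, rfl⟩
    exact hnonneg x
  · intro i j
    simp only [Set.uIcc_comm]
  · intro i j k
    refine le_csInf (Set.nonempty_uIcc.image h) ?_
    rintro _ ⟨x, hx, rfl⟩
    rcases Set.uIcc_subset_uIcc_union_uIcc (b := s j) hx with hx | hx
    · exact (min_le_left _ _).trans (csInf_le (hbdd _) ⟨x, hx, rfl⟩)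
    · exact (min_le_right _ _).trans (csInf_le (hbdd _) ⟨x, hx, rfl⟩)
end

section
/- Define f(z,s) = (√3/(2π)) √z s^{−5/2} exp(−z²/(2s)) for z > 0, s > 0. Then for every λ > 0 and μ > 0, ∫₀^∞ ∫₀^∞ s · e^{−λz − μs} f(z,s) dz ds = √(3/2) · (λ + √(2μ))^{−1/2}. (This identifies f as the joint density of the boundary length Z₀* and the mass σ of an excursion under the excursion measure ℕ₀*.) -/
open MeasureTheory

/-- the claimed joint density `f(z,s) = (√3/(2π)) √z s^{-5/2} exp(-z²/(2s))` of the
pair (boundary length `Z₀*`, duration `σ`) under the excursion measure `ℕ₀*`. -/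
noncomputable def excDensity (z s : ℝ) : ℝ :=
  (Real.sqrt 3 / (2 * Real.pi)) * Real.sqrt z * s ^ (-(5:ℝ)/2) *
    Real.exp (-(z ^ 2) / (2 * s))

open Filter Topology Set

private lemma hasDerivAt_gaussPrimitive (x : ℝ) :
    HasDerivAt (fun x : ℝ => ∫ y in (0:ℝ)..x, Real.exp (-1 * y ^ 2)) (Real.exp (-x ^ 2)) x := by
  have hc : Continuous fun y : ℝ => Real.exp (-1 * y ^ 2) := by fun_prop
  simpa using hc.integral_hasStrictDerivAt 0 x |>.hasDerivAt

private lemma tendsto_gaussPrimitive_atTop :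
    Tendsto (fun x : ℝ => ∫ y in (0:ℝ)..x, Real.exp (-1 * y ^ 2)) atTop
      (𝓝 (Real.sqrt Real.pi / 2)) := by
  have h := intervalIntegral_tendsto_integral_Ioi (μ := volume) 0
    (integrable_exp_neg_mul_sq one_pos).integrableOn tendsto_id
  rw [integral_gaussian_Ioi, div_one] at h
  exact h

private lemma tendsto_gaussPrimitive_atBot :
    Tendsto (fun x : ℝ => ∫ y in (0:ℝ)..x, Real.exp (-1 * y ^ 2)) atBot
      (𝓝 (-(Real.sqrt Real.pi / 2))) := by
  have h := (tendsto_gaussPrimitive_atTop.comp tendsto_neg_atBot_atTop).neg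
  refine h.congr fun x => ?_
  have := intervalIntegral.integral_comp_neg (a := 0) (b := x)
    (fun y : ℝ => Real.exp (-1 * y ^ 2))
  simp only [Function.comp_apply]
  rw [intervalIntegral.integral_symm, neg_neg]
  simpa using this.symm

private lemma hasDerivAt_exp_mul_gaussPrimitive (z c : ℝ) {s : ℝ} (hs : 0 < s) :
    HasDerivAt (fun s : ℝ => Real.exp (z * c) *
        ∫ y in (0:ℝ)..((z + c * s) / (√2 * √s)), Real.exp (-1 * y ^ 2))
      (Real.exp (-(z ^ 2) / (2 * s) - c ^ 2 / 2 * s) * ((c * s - z) / (2 * √2 * (s * √s)))) s := by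
  have hs' : 0 < √s := Real.sqrt_pos.2 hs
  have h2 : 0 < √(2:ℝ) := by positivity
  have hden : HasDerivAt (fun s : ℝ => √2 * √s) (√2 * (1 / (2 * √s))) s :=
    (Real.hasDerivAt_sqrt hs.ne').const_mul _
  have hnum : HasDerivAt (fun s : ℝ => z + c * s) c s := by
    simpa using ((hasDerivAt_id s).const_mul c).const_add z
  have h := ((hasDerivAt_gaussPrimitive _).comp s
    (hnum.div hden (by positivity))).const_mul (Real.exp (z * c))
  refine h.congr_deriv ?_
  have hexp : Real.exp (z * c) * Real.exp (-((z + c * s) / (√2 * √s)) ^ 2)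
      = Real.exp (-(z ^ 2) / (2 * s) - c ^ 2 / 2 * s) := by
    rw [← Real.exp_add, div_pow, mul_pow, Real.sq_sqrt hs.le, Real.sq_sqrt zero_le_two]
    congr 1
    field_simp
    ring
  simp only [Pi.div_apply]
  rw [← mul_assoc, hexp]
  congr 1
  obtain ⟨r, hr, rfl⟩ : ∃ r, 0 < r ∧ s = r ^ 2 := ⟨√s, hs', (Real.sq_sqrt hs.le).symm⟩
  rw [Real.sqrt_sq hr.le]
  field_simp
  ring

private lemma tendsto_sqrt_two_mul_sqrt_zero : Tendsto (fun s : ℝ => √2 * √s) (𝓝[>] 0) (𝓝[>] 0) := by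
  refine tendsto_nhdsWithin_iff.2 ⟨?_, ?_⟩
  · have : Continuous fun s : ℝ => √2 * √s := by fun_prop
    simpa using (this.tendsto 0).mono_left nhdsWithin_le_nhds
  · filter_upwards [self_mem_nhdsWithin] with s hs
    have : 0 < √s := Real.sqrt_pos.2 hs
    exact mul_pos (by positivity) this

private lemma tendsto_arg_zero {z : ℝ} (hz : 0 < z) (c : ℝ) :
    Tendsto (fun s : ℝ => (z + c * s) / (√2 * √s)) (𝓝[>] 0) atTop := by
  have h1 : Tendsto (fun s : ℝ => z + c * s) (𝓝[>] 0) (𝓝 z) := by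
    have : Continuous fun s : ℝ => z + c * s := by fun_prop
    simpa using (this.tendsto 0).mono_left nhdsWithin_le_nhds
  simpa [div_eq_mul_inv] using
    h1.pos_mul_atTop hz (tendsto_inv_nhdsGT_zero.comp tendsto_sqrt_two_mul_sqrt_zero)

private lemma arg_eq (z c : ℝ) {s : ℝ} (hs : 0 < s) :
    (z + c * s) / (√2 * √s) = √s * ((z * s⁻¹ + c) / √2) := by
  have hs' : 0 < √s := Real.sqrt_pos.2 hs
  obtain ⟨r, hr, rfl⟩ : ∃ r, 0 < r ∧ s = r ^ 2 := ⟨√s, hs', (Real.sq_sqrt hs.le).symm⟩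
  rw [Real.sqrt_sq hr.le]
  field_simp

private lemma tendsto_arg_factor (z c : ℝ) :
    Tendsto (fun s : ℝ => (z * s⁻¹ + c) / √2) atTop (𝓝 (c / √2)) := by
  simpa using ((tendsto_inv_atTop_zero.const_mul z).add_const c).div_const (√2)

private lemma tendsto_arg_atTop (z : ℝ) {c : ℝ} (hc : 0 < c) :
    Tendsto (fun s : ℝ => (z + c * s) / (√2 * √s)) atTop atTop := by
  refine (Real.tendsto_sqrt_atTop.atTop_mul_pos (by positivity)
    (tendsto_arg_factor z c)).congr' ?_
  filter_upwards [eventually_gt_atTop 0] with s hs using (arg_eq z c hs).symm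

private lemma tendsto_arg_atBot (z : ℝ) {c : ℝ} (hc : c < 0) :
    Tendsto (fun s : ℝ => (z + c * s) / (√2 * √s)) atTop atBot := by
  refine (Real.tendsto_sqrt_atTop.atTop_mul_neg (div_neg_of_neg_of_pos hc (by positivity))
    (tendsto_arg_factor z c)).congr' ?_
  filter_upwards [eventually_gt_atTop 0] with s hs using (arg_eq z c hs).symm

/-- The Laplace transform of the (unnormalised) first-passage density of Brownian motion. -/
private lemma integral_firstPassage {z c : ℝ} (hz : 0 < z) (hc : 0 < c) :
    IntegrableOn (fun s : ℝ => Real.exp (-(z ^ 2) / (2 * s) - c ^ 2 / 2 * s) / (s * √s)) (Ioi 0) ∧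
    ∫ s in Ioi (0:ℝ), Real.exp (-(z ^ 2) / (2 * s) - c ^ 2 / 2 * s) / (s * √s)
      = √2 * √Real.pi / z * Real.exp (-(c * z)) := by
  set H : ℝ → ℝ := fun s =>
    (-(√2 / z)) * (Real.exp (z * c) *
        (∫ y in (0:ℝ)..((z + c * s) / (√2 * √s)), Real.exp (-1 * y ^ 2)) +
      Real.exp (z * -c) *
        ∫ y in (0:ℝ)..((z + -c * s) / (√2 * √s)), Real.exp (-1 * y ^ 2))
  set L : ℝ := (-(√2 / z)) * (Real.exp (z * c) * (√Real.pi / 2) +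
      Real.exp (z * -c) * (√Real.pi / 2)) with hL
  have hzero : Tendsto H (𝓝[>] 0) (𝓝 L) :=
    (((tendsto_gaussPrimitive_atTop.comp (tendsto_arg_zero hz c)).const_mul _).add
      ((tendsto_gaussPrimitive_atTop.comp (tendsto_arg_zero hz (-c))).const_mul _)).const_mul _
  have htop : Tendsto H atTop (𝓝 ((-(√2 / z)) * (Real.exp (z * c) * (√Real.pi / 2) +
      Real.exp (z * -c) * (-(√Real.pi / 2))))) :=
    (((tendsto_gaussPrimitive_atTop.comp (tendsto_arg_atTop z hc)).const_mul _).add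
      ((tendsto_gaussPrimitive_atBot.comp
        (tendsto_arg_atBot z (neg_neg_of_pos hc))).const_mul _)).const_mul _
  have hderiv : ∀ s ∈ Ioi (0:ℝ), HasDerivAt (Function.update H 0 L)
      (Real.exp (-(z ^ 2) / (2 * s) - c ^ 2 / 2 * s) / (s * √s)) s := by
    intro s hs
    have hs0 : 0 < s := hs
    have h := ((hasDerivAt_exp_mul_gaussPrimitive z c hs0).add
      (hasDerivAt_exp_mul_gaussPrimitive z (-c) hs0)).const_mul (-(√2 / z))
    refine (h.congr_deriv ?_).congr_of_eventuallyEq ?_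
    · have hs' : 0 < √s := Real.sqrt_pos.2 hs0
      rw [neg_sq, ← mul_add]
      field_simp
      ring
    · filter_upwards [lt_mem_nhds hs0] with x hx
      rw [Function.update_of_ne hx.ne']
      rfl
  have hcont : ContinuousWithinAt (Function.update H 0 L) (Ici 0) 0 := by
    rw [continuousWithinAt_update_same, Ici_sdiff_left]
    exact hzero
  have hpos : ∀ s ∈ Ioi (0:ℝ),
      0 ≤ Real.exp (-(z ^ 2) / (2 * s) - c ^ 2 / 2 * s) / (s * √s) := by
    intro s hs
    have : 0 < s := hs
    positivity
  have htop' : Tendsto (Function.update H 0 L) atTop _ := htop.congr' <| by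
    filter_upwards [eventually_gt_atTop 0] with x hx
    rw [Function.update_of_ne hx.ne']
  refine ⟨integrableOn_Ioi_deriv_of_nonneg hcont hderiv hpos htop', ?_⟩
  rw [integral_Ioi_of_hasDerivAt_of_nonneg hcont hderiv hpos htop', Function.update_self, hL,
    show -(c * z) = z * -c by ring]
  ring

private lemma integrand_eq (lam mu : ℝ) {z s : ℝ} (hs : 0 < s) (hmu : 0 < mu) :
    s * Real.exp (-(lam * z) - mu * s) * excDensity z s
      = (√3 / (2 * Real.pi) * √z * Real.exp (-(lam * z))) *
        (Real.exp (-(z ^ 2) / (2 * s) - (√(2 * mu)) ^ 2 / 2 * s) / (s * √s)) := by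
  have hp : s * s ^ (-(5:ℝ)/2) = (s * √s)⁻¹ := by
    rw [Real.sqrt_eq_rpow, ← Real.rpow_one_add' hs.le (by norm_num),
      ← Real.rpow_one_add' hs.le (by norm_num), ← Real.rpow_neg hs.le]
    norm_num
  have he : Real.exp (-(lam * z) - mu * s) * Real.exp (-(z ^ 2) / (2 * s))
      = Real.exp (-(lam * z)) * Real.exp (-(z ^ 2) / (2 * s) - (√(2 * mu)) ^ 2 / 2 * s) := by
    rw [← Real.exp_add, ← Real.exp_add, Real.sq_sqrt (by positivity)]
    congr 1
    ring
  rw [excDensity, div_eq_mul_inv _ (s * √s), ← hp]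
  linear_combination (s * s ^ (-(5:ℝ)/2) * (√3 / (2 * Real.pi)) * √z) * he

/-- For every `λ > 0`, `μ > 0`,
`∫₀^∞ ∫₀^∞ s e^{-λz - μs} f(z,s) dz ds = √(3/2) (λ + √(2μ))^{-1/2}`. -/
theorem excDensity_laplace (lam mu : ℝ) (hlam : 0 < lam) (hmu : 0 < mu) :
    (∫ s in Set.Ioi (0:ℝ), ∫ z in Set.Ioi (0:ℝ),
        s * Real.exp (-(lam * z) - mu * s) * excDensity z s)
      = Real.sqrt (3/2) * (lam + Real.sqrt (2 * mu)) ^ (-(1:ℝ)/2) := by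
  set c : ℝ := √(2 * mu)
  have hc : 0 < c := Real.sqrt_pos.2 (by positivity)
  have hr : 0 < lam + c := by positivity
  have hsection : ∀ z ∈ Ioi (0:ℝ),
      IntegrableOn (fun s : ℝ => s * Real.exp (-(lam * z) - mu * s) * excDensity z s) (Ioi 0) ∧
      ∫ s in Ioi (0:ℝ), s * Real.exp (-(lam * z) - mu * s) * excDensity z s
        = √3 * √2 * √Real.pi / (2 * Real.pi) *
          (z ^ ((1:ℝ) / 2 - 1) * Real.exp (-((lam + c) * z))) := by
    intro z hz
    have hz0 : 0 < z := hz
    obtain ⟨hint, hval⟩ := integral_firstPassage hz0 hc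
    refine ⟨?_, ?_⟩
    · exact IntegrableOn.congr_fun (Integrable.const_mul hint _)
        (fun s hs => (integrand_eq lam mu hs hmu).symm) measurableSet_Ioi
    · rw [setIntegral_congr_fun measurableSet_Ioi fun s hs => integrand_eq lam mu hs hmu,
        integral_const_mul, hval, Real.rpow_sub_one hz0.ne', ← Real.sqrt_eq_rpow,
        show -((lam + c) * z) = -(lam * z) + -(c * z) by ring, Real.exp_add]
      ring
  have hmarginal : IntegrableOn (fun z : ℝ =>
      z ^ ((1:ℝ) / 2 - 1) * Real.exp (-((lam + c) * z))) (Ioi 0) := by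
    simpa only [Real.rpow_one, neg_mul] using integrableOn_rpow_mul_exp_neg_mul_rpow (s := (1:ℝ) / 2 - 1) (p := 1)
      (by norm_num) one_pos hr
  have hint : Integrable (Function.uncurry fun s z : ℝ =>
      s * Real.exp (-(lam * z) - mu * s) * excDensity z s)
      ((volume.restrict (Ioi 0)).prod (volume.restrict (Ioi 0))) := by
    refine (integrable_prod_iff' ?_).2 ⟨?_, ?_⟩
    · refine Measurable.aestronglyMeasurable ?_
      unfold Function.uncurry excDensity
      fun_prop
    · filter_upwards [ae_restrict_mem measurableSet_Ioi] with z hz using (hsection z hz).1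
    · refine IntegrableOn.congr_fun (Integrable.const_mul hmarginal
        (√3 * √2 * √Real.pi / (2 * Real.pi))) (fun z hz => ?_) measurableSet_Ioi
      refine (hsection z hz).2.symm.trans ?_
      refine setIntegral_congr_fun measurableSet_Ioi fun s hs => ?_
      have hs0 : 0 < s := hs
      refine (Real.norm_of_nonneg ?_).symm
      simp only [excDensity]
      positivity
  rw [integral_integral_swap hint,
    setIntegral_congr_fun measurableSet_Ioi fun z hz => (hsection z hz).2, integral_const_mul,
    Real.integral_rpow_mul_exp_neg_mul_Ioi (by norm_num) hr, Real.Gamma_one_half_eq,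
    one_div (lam + c), Real.inv_rpow hr.le, ← Real.rpow_neg hr.le, neg_div,
    Real.sqrt_div (by norm_num)]
  have hpi : √Real.pi * √Real.pi = Real.pi := Real.mul_self_sqrt Real.pi_pos.le
  have h2 : √(2:ℝ) * √2 = 2 := Real.mul_self_sqrt zero_le_two
  have hconst : √3 * √2 * √Real.pi / (2 * Real.pi) * √Real.pi = √3 / √2 := by
    rw [div_mul_eq_mul_div, div_eq_div_iff (by positivity) (by positivity)]
    linear_combination √3 * (√2 * √2) * hpi + √3 * Real.pi * h2
  rw [← hconst]
  ring
end

section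
/- Fix μ > 0 and, for 0 < λ < √(μ/2), define u_{λ,μ}(b) = √(μ/2) · ( 3 tanh²( (2μ)^{1/4} b + artanh √(2/3 + (1/3)√(2/μ) λ) ) − 2 ) for b ≥ 0. Then for each b ≥ 0 the map λ ↦ u_{λ,μ}(b) is differentiable on (0, √(μ/2)) with ∂u_{λ,μ}(b)/∂λ = K_{λ,μ}^{−1} · tanh(θ_b) · cosh(θ_b)^{−2}, where θ_b = (2μ)^{1/4} b + artanh √(2/3 + (1/3)√(2/μ) λ) and K_{λ,μ} = (1/3)(1 − √(2/μ) λ) · √(2/3 + (1/3)√(2/μ) λ); moreover ∫₀^∞ (∂u_{λ,μ}/∂λ)(b) db = (1/2) √(3/2) · (λ + √(2μ))^{−1/2}. -/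
open MeasureTheory

/-- the inverse hyperbolic tangent `artanh x = (1/2) log((1+x)/(1-x))`. -/
noncomputable def artanh (x : ℝ) : ℝ := Real.log ((1 + x) / (1 - x)) / 2

/-- `θ_b = (2μ)^{1/4} b + artanh √(2/3 + (1/3) √(2/μ) λ)`. -/
noncomputable def thetaFun (mu lam b : ℝ) : ℝ :=
  (2 * mu) ^ ((1:ℝ)/4) * b + artanh (Real.sqrt (2/3 + (1/3) * Real.sqrt (2/mu) * lam))

/-- `u_{λ,μ}(b) = √(μ/2) (3 tanh²(θ_b) - 2)`. -/
noncomputable def uFun (mu lam b : ℝ) : ℝ :=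
  Real.sqrt (mu / 2) * (3 * Real.tanh (thetaFun mu lam b) ^ 2 - 2)

/-- `K_{λ,μ} = (1/3)(1 - √(2/μ) λ) √(2/3 + (1/3) √(2/μ) λ)`. -/
noncomputable def Kfun (mu lam : ℝ) : ℝ :=
  (1/3) * (1 - Real.sqrt (2/mu) * lam) * Real.sqrt (2/3 + (1/3) * Real.sqrt (2/mu) * lam)

theorem hasDerivAt_inv_cosh_sq (x : ℝ) :
    HasDerivAt (fun y => (Real.cosh y ^ 2)⁻¹)
      (-2 * Real.tanh x * (Real.cosh x ^ 2)⁻¹) x := by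
  have hc := (Real.cosh_pos x).ne'
  refine (((Real.hasDerivAt_cosh x).pow 2).inv (pow_ne_zero 2 hc)).congr_deriv ?_
  rw [Real.tanh_eq_sinh_div_cosh]
  simp only [Pi.pow_apply]
  field_simp
  norm_num
  ring

theorem tanh_sq_eq_one_sub_inv_cosh_sq (x : ℝ) :
    Real.tanh x ^ 2 = 1 - (Real.cosh x ^ 2)⁻¹ := by
  have hc := (Real.cosh_pos x).ne'
  rw [Real.tanh_eq_sinh_div_cosh, div_pow, Real.sinh_sq]
  field_simp

theorem tendsto_inv_cosh_sq_atTop :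
    Filter.Tendsto (fun x : ℝ => (Real.cosh x ^ 2)⁻¹) Filter.atTop (nhds 0) := by
  refine Filter.Tendsto.inv_tendsto_atTop ?_
  refine (Filter.tendsto_pow_atTop two_ne_zero).comp ?_
  refine Filter.tendsto_atTop_mono' _ ?_ Filter.tendsto_id
  filter_upwards [Filter.eventually_ge_atTop 0] with x hx
  exact (Real.self_le_sinh_iff.2 hx).trans (Real.sinh_lt_cosh x).le

theorem artanh_eq_real_artanh {x : ℝ} (hx : x ∈ Set.Ioo (-1) 1) :
    artanh x = Real.artanh x := by
  rw [Real.artanh_eq_half_log (Set.Ioo_subset_Icc_self hx), artanh]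
  ring

theorem hasDerivAt_artanh {x : ℝ} (hx : x ∈ Set.Ioo (-1) 1) :
    HasDerivAt artanh (1 - x ^ 2)⁻¹ x := by
  have h1 : 1 + x ≠ 0 := by linarith [hx.1]
  have h2 : 1 - x ≠ 0 := by linarith [hx.2]
  have h3 : 1 - x ^ 2 ≠ 0 := by
    rw [show 1 - x ^ 2 = (1 + x) * (1 - x) by ring]
    exact mul_ne_zero h1 h2
  refine (((((hasDerivAt_id x).const_add 1).div ((hasDerivAt_id x).const_sub 1) h2).log
    (div_ne_zero h1 h2)).div_const 2).congr_deriv ?_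
  simp only [id, Pi.div_apply]
  field_simp
  ring

theorem inv_cosh_artanh_sq {x : ℝ} (hx : x ∈ Set.Ioo (-1) 1) :
    (Real.cosh (artanh x) ^ 2)⁻¹ = 1 - x ^ 2 := by
  rw [artanh_eq_real_artanh hx, ← sub_sub_cancel 1 (Real.cosh _ ^ 2)⁻¹,
    ← tanh_sq_eq_one_sub_inv_cosh_sq, Real.tanh_artanh hx]

theorem sqrt_two_div_mul_lt_one {mu lam : ℝ} (hmu : 0 < mu) (hlam : lam < Real.sqrt (mu / 2)) :
    Real.sqrt (2 / mu) * lam < 1 := by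
  have h : Real.sqrt (2 / mu) * Real.sqrt (mu / 2) = 1 := by
    rw [← Real.sqrt_mul (by positivity)]
    field_simp
    simp
  rw [← h]
  have : 0 < Real.sqrt (2 / mu) := by positivity
  gcongr

/-- Fix `μ > 0`. For every `b ≥ 0`, the map `λ ↦ u_{λ,μ}(b)` is differentiable on
`(0, √(μ/2))` with derivative `K_{λ,μ}^{-1} tanh(θ_b) cosh(θ_b)^{-2}`; moreover
`∫₀^∞ (∂u_{λ,μ}/∂λ)(b) db = (1/2) √(3/2) (λ + √(2μ))^{-1/2}`. -/
theorem deriv_uFun_and_integral (mu : ℝ) (hmu : 0 < mu) :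
    (∀ b : ℝ, 0 ≤ b → ∀ lam : ℝ, lam ∈ Set.Ioo 0 (Real.sqrt (mu / 2)) →
      HasDerivAt (fun l => uFun mu l b)
        ((Kfun mu lam)⁻¹ * Real.tanh (thetaFun mu lam b)
          * (Real.cosh (thetaFun mu lam b) ^ 2)⁻¹) lam) ∧
    (∀ lam : ℝ, lam ∈ Set.Ioo 0 (Real.sqrt (mu / 2)) →
      (∫ b in Set.Ioi (0:ℝ),
          (Kfun mu lam)⁻¹ * Real.tanh (thetaFun mu lam b)
            * (Real.cosh (thetaFun mu lam b) ^ 2)⁻¹)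
        = (1/2) * Real.sqrt (3/2) * (lam + Real.sqrt (2 * mu)) ^ (-(1:ℝ)/2)) := by
  have key : ∀ lam ∈ Set.Ioo 0 (Real.sqrt (mu / 2)),
      0 < 1 - Real.sqrt (2 / mu) * lam ∧ 0 < 2 / 3 + (1 / 3) * Real.sqrt (2 / mu) * lam ∧
        Real.sqrt (2 / 3 + (1 / 3) * Real.sqrt (2 / mu) * lam) ∈ Set.Ioo 0 1 := by
    intro lam hlam
    have h1 := sqrt_two_div_mul_lt_one hmu hlam.2
    have h2 : 0 ≤ Real.sqrt (2 / mu) * lam := mul_nonneg (Real.sqrt_nonneg _) hlam.1.le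
    refine ⟨by linarith, by linarith, Real.sqrt_pos.2 (by linarith), ?_⟩
    rw [Real.sqrt_lt' one_pos]
    linarith
  refine ⟨fun b _ lam hlam => ?_, fun lam hlam => ?_⟩
  · obtain ⟨h1, h2, hs0, hs1⟩ := key lam hlam
    have hprod : Real.sqrt (mu / 2) * Real.sqrt (2 / mu) = 1 := by
      rw [← Real.sqrt_mul (by positivity)]
      field_simp
      simp
    have hsq := Real.sq_sqrt h2.le
    have hθ : HasDerivAt (fun l => thetaFun mu l b) _ lam :=
      ((hasDerivAt_artanh ⟨by linarith, hs1⟩).comp lam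
        ((((hasDerivAt_id lam).const_mul ((1 / 3) * Real.sqrt (2 / mu))).const_add
          (2 / 3)).sqrt h2.ne')).const_add _
    have hu := ((((hasDerivAt_inv_cosh_sq _).comp lam hθ).const_sub 1).const_mul 3
      |>.sub_const 2).const_mul (Real.sqrt (mu / 2))
    have hfun : (fun l => uFun mu l b) = fun l => Real.sqrt (mu / 2) *
        (3 * (1 - (Real.cosh (thetaFun mu l b) ^ 2)⁻¹) - 2) := by
      funext l
      rw [uFun, tanh_sq_eq_one_sub_inv_cosh_sq]
    rw [hfun]
    refine hu.congr_deriv ?_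
    simp only [id]
    rw [hsq, Kfun, show 1 - (2 / 3 + 1 / 3 * Real.sqrt (2 / mu) * lam) =
      (1 / 3) * (1 - Real.sqrt (2 / mu) * lam) by ring]
    generalize Real.sqrt (2 / 3 + 1 / 3 * Real.sqrt (2 / mu) * lam) = s at *
    generalize 1 - Real.sqrt (2 / mu) * lam = k at *
    generalize Real.tanh (thetaFun mu lam b) = t
    generalize (Real.cosh (thetaFun mu lam b) ^ 2)⁻¹ = c
    trans (Real.sqrt (mu / 2) * Real.sqrt (2 / mu)) * ((1 / 3 * k * s)⁻¹ * t * c)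
    · field_simp
    · rw [hprod, one_mul]
  · obtain ⟨h1, h2, hs0, hs1⟩ := key lam hlam
    have hα : 0 < (2 * mu) ^ ((1 : ℝ) / 4) := by positivity
    have hK : 0 < Kfun mu lam := by
      unfold Kfun
      positivity
    have hsq := Real.sq_sqrt h2.le
    have hart : 0 ≤ artanh (Real.sqrt (2 / 3 + (1 / 3) * Real.sqrt (2 / mu) * lam)) := by
      rw [artanh_eq_real_artanh ⟨by linarith, hs1⟩]
      exact Real.artanh_nonneg hs0.le
    have hθ (b : ℝ) : HasDerivAt (thetaFun mu lam) ((2 * mu) ^ ((1 : ℝ) / 4)) b := by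
      exact (((hasDerivAt_id b).const_mul ((2 * mu) ^ ((1 : ℝ) / 4))).add_const
        (artanh (Real.sqrt (2 / 3 + (1 / 3) * Real.sqrt (2 / mu) * lam)))).congr_deriv (mul_one _)
    have hθtop : Filter.Tendsto (thetaFun mu lam) Filter.atTop Filter.atTop :=
      Filter.tendsto_atTop_add_const_right _ _ (Filter.tendsto_id.const_mul_atTop hα)
    have hderiv (b : ℝ) := ((hasDerivAt_inv_cosh_sq _).comp b (hθ b)).const_mul
      (-(2 * (2 * mu) ^ ((1 : ℝ) / 4) * Kfun mu lam)⁻¹)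
    have hderiv' (b : ℝ) := (hderiv b).congr_deriv (g' := (Kfun mu lam)⁻¹ *
      Real.tanh (thetaFun mu lam b) * (Real.cosh (thetaFun mu lam b) ^ 2)⁻¹) (by field_simp)
    rw [integral_Ioi_of_hasDerivAt_of_nonneg' (fun b _ => hderiv' b) ?_
      ((tendsto_inv_cosh_sq_atTop.comp hθtop).const_mul _)]
    · have h0 : thetaFun mu lam 0 =
          artanh (Real.sqrt (2 / 3 + (1 / 3) * Real.sqrt (2 / mu) * lam)) := by
        simp [thetaFun]
      simp only [Function.comp_apply]
      rw [h0, inv_cosh_artanh_sq ⟨by linarith, hs1⟩, hsq]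
      have hroot : (2 * mu) ^ ((1 : ℝ) / 4) = Real.sqrt (Real.sqrt (2 * mu)) := by
        rw [Real.sqrt_eq_rpow, Real.sqrt_eq_rpow, ← Real.rpow_mul (by positivity)]
        norm_num
      have hprod : Real.sqrt (2 * mu) * Real.sqrt (2 / mu) = 2 := by
        rw [← Real.sqrt_mul (by positivity), Real.sqrt_eq_iff_mul_self_eq (by positivity)
          (by norm_num)]
        field_simp
      have hαs : (2 * mu) ^ ((1 : ℝ) / 4) *
          Real.sqrt (2 / 3 + (1 / 3) * Real.sqrt (2 / mu) * lam) =
          (Real.sqrt (3 / 2))⁻¹ * Real.sqrt (lam + Real.sqrt (2 * mu)) := by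
        rw [hroot, ← Real.sqrt_mul (by positivity), ← Real.sqrt_inv,
          ← Real.sqrt_mul (by positivity)]
        congr 1
        linear_combination (1 / 3) * lam * hprod
      have hpos : 0 < lam + Real.sqrt (2 * mu) :=
        add_pos_of_pos_of_nonneg hlam.1 (Real.sqrt_nonneg _)
      rw [show -(1 : ℝ) / 2 = -(1 / 2) by norm_num, Real.rpow_neg hpos.le,
        ← Real.sqrt_eq_rpow]
      trans (1 / 2) * ((2 * mu) ^ ((1 : ℝ) / 4) *
          Real.sqrt (2 / 3 + (1 / 3) * Real.sqrt (2 / mu) * lam))⁻¹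
      · rw [Kfun, show 1 - (2 / 3 + 1 / 3 * Real.sqrt (2 / mu) * lam) =
          (1 / 3) * (1 - Real.sqrt (2 / mu) * lam) by ring]
        generalize Real.sqrt (2 / 3 + 1 / 3 * Real.sqrt (2 / mu) * lam) = s at *
        generalize 1 - Real.sqrt (2 / mu) * lam = k at *
        field_simp
        ring
      · rw [hαs, mul_inv, inv_inv, mul_assoc]
    · intro b hb
      have hθ0 : 0 ≤ thetaFun mu lam b := add_nonneg (mul_nonneg hα.le (le_of_lt hb)) hart
      have ht : 0 ≤ Real.tanh (thetaFun mu lam b) := by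
        rw [Real.tanh_eq_sinh_div_cosh]
        exact div_nonneg (Real.sinh_nonneg_iff.2 hθ0) (Real.cosh_pos _).le
      positivity
end
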